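/- arXiv:2301.11992 — 2 statements merged into one kernel-verified Lean document; each statement's English description precedes it below -/
import Mathlib

section
/- Let ρ(r) = r + √(1 + r²). There exists a function C : (0,∞) × [1,∞) → (0,∞), monotonically increasing in its first argument, such that for every δ ≥ 1, every C_G, A > 0, every function f of Gevrey class G^δ([−1,1], C_G, A), and every integer m ≥ 3, the best uniform polynomial approximation error satisfies min_{p ∈ 𝒫_m} sup_{x ∈ [−1,1]} |f(x) − p(x)| ≤ C(A,δ) · C_G · ρ(1/A)^{−m^{1/δ}/e²}. -/
/-- `ρ(r) = r + √(1 + r²)`. -/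
noncomputable def rho (r : ℝ) : ℝ := r + Real.sqrt (1 + r ^ 2)

/-- `f : ℝ → ℝ` is of Gevrey class `G^δ([a,b], C_G, A)`: it is `C^∞` on a
neighborhood of `[a,b]` and satisfies `|f⁽ⁿ⁾(x)| ≤ C_G·Aⁿ·(n!)^δ` on `[a,b]`. -/
def GevreyOn (a b δ CG A : ℝ) (f : ℝ → ℝ) : Prop :=
  (∃ U : Set ℝ, IsOpen U ∧ Set.Icc a b ⊆ U ∧ ContDiffOn ℝ (⊤ : ℕ∞) f U) ∧
    ∀ n : ℕ, ∀ x ∈ Set.Icc a b,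
      |iteratedDeriv n f x| ≤ CG * A ^ n * (n.factorial : ℝ) ^ δ

theorem sum_cos_eq_zero {N : ℕ} {z : ℤ} (hz : z ≠ 0) (hzN : |z| < N) (θ : ℝ) :
    ∑ j ∈ Finset.range N, Real.cos (z * (θ - 2 * Real.pi * j / N)) = 0 := by
  have hN : (N : ℂ) ≠ 0 := by
    have : 0 < (N : ℤ) := (abs_nonneg z).trans_lt hzN
    exact_mod_cast this.ne'
  set w : ℂ := Complex.exp (-(z * (2 * Real.pi / N)) * Complex.I) with hw
  have hw1 : w ≠ 1 := by
    intro h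
    rw [hw, Complex.exp_eq_one_iff] at h
    obtain ⟨t, ht⟩ := h
    have hpi : (Real.pi : ℂ) ≠ 0 := by exact_mod_cast Real.pi_ne_zero
    have h2 : (-z : ℂ) = t * N := by
      field_simp at ht
      linear_combination ht
    have h3 : -z = t * N := by exact_mod_cast h2
    have h4 : z = 0 := Int.eq_zero_of_abs_lt_dvd (m := (N : ℤ)) ⟨-t, by linarith⟩ hzN
    exact hz h4
  have hwN : w ^ N = 1 := by
    rw [hw, ← Complex.exp_nat_mul, Complex.exp_eq_one_iff]
    exact ⟨-z, by push_cast; field_simp⟩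
  have hsum : ∑ j ∈ Finset.range N, w ^ j = 0 := by
    rw [geom_sum_eq hw1, hwN]; simp
  have key : ∀ j : ℕ, Real.cos (z * (θ - 2 * Real.pi * j / N)) =
      (Complex.exp (z * θ * Complex.I) * w ^ j).re := by
    intro j
    rw [hw, ← Complex.exp_nat_mul, ← Complex.exp_add, ← Complex.exp_ofReal_mul_I_re]
    congr 2
    push_cast
    field_simp
    ring
  simp_rw [key]
  rw [← Complex.re_sum, ← Finset.mul_sum, hsum]
  simp

theorem sum_cos_eq_ite {N : ℕ} (z : ℤ) (hzN : |z| < N) (θ : ℝ) :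
    ∑ j ∈ Finset.range N, Real.cos (z * (θ - 2 * Real.pi * j / N)) =
      if z = 0 then (N : ℝ) else 0 := by
  split_ifs with h
  · simp [h]
  · exact sum_cos_eq_zero h hzN θ

/-- The squared modulus of the trigonometric polynomial with coefficients `a 0, …, a n`. -/
noncomputable def trigKernel (a : ℕ → ℝ) (n : ℕ) (t : ℝ) : ℝ :=
  ∑ k ∈ Finset.range (n + 1), ∑ l ∈ Finset.range (n + 1),
    a k * a l * Real.cos (((k - l : ℤ) : ℝ) * t)

theorem trigKernel_nonneg (a : ℕ → ℝ) (n : ℕ) (t : ℝ) : 0 ≤ trigKernel a n t := by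
  have : trigKernel a n t = (∑ k ∈ Finset.range (n + 1), a k * Real.cos (k * t)) ^ 2 +
      (∑ k ∈ Finset.range (n + 1), a k * Real.sin (k * t)) ^ 2 := by
    rw [sq, sq, Finset.sum_mul_sum, Finset.sum_mul_sum, ← Finset.sum_add_distrib, trigKernel]
    refine Finset.sum_congr rfl fun k _ => ?_
    rw [← Finset.sum_add_distrib]
    refine Finset.sum_congr rfl fun l _ => ?_
    push_cast
    rw [sub_mul, Real.cos_sub]
    ring
  rw [this]
  positivity

theorem sum_trigKernel (a : ℕ → ℝ) (n : ℕ) (θ : ℝ) :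
    ∑ j ∈ Finset.range (n + 2), trigKernel a n (θ - 2 * Real.pi * j / (n + 2 : ℕ)) =
      (n + 2 : ℕ) * ∑ k ∈ Finset.range (n + 1), a k ^ 2 := by
  unfold trigKernel
  rw [Finset.sum_comm, Finset.mul_sum]
  refine Finset.sum_congr rfl fun k hk => ?_
  rw [Finset.sum_comm]
  have : ∀ l ∈ Finset.range (n + 1), ∑ j ∈ Finset.range (n + 2),
      a k * a l * Real.cos (((k - l : ℤ) : ℝ) * (θ - 2 * Real.pi * j / (n + 2 : ℕ))) =
      if k = l then (n + 2 : ℕ) * (a k * a l) else 0 := by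
    intro l hl
    rw [Finset.mem_range] at hk hl
    rw [← Finset.mul_sum, sum_cos_eq_ite _ (by rw [abs_lt]; constructor <;> push_cast <;> omega)]
    by_cases h : k = l
    · simp [h]; ring
    · rw [if_neg h, if_neg (by omega), mul_zero]
  rw [Finset.sum_congr rfl this, Finset.sum_ite_eq, if_pos hk]
  ring

theorem sum_cos_mul_trigKernel (a : ℕ → ℝ) (n : ℕ) (ha : a (n + 1) = 0) (θ : ℝ) :
    ∑ j ∈ Finset.range (n + 2), Real.cos (θ - 2 * Real.pi * j / (n + 2 : ℕ)) *
        trigKernel a n (θ - 2 * Real.pi * j / (n + 2 : ℕ)) =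
      (n + 2 : ℕ) * ∑ k ∈ Finset.range (n + 1), a k * a (k + 1) := by
  have key : ∀ k ∈ Finset.range (n + 1), ∀ l ∈ Finset.range (n + 1),
      ∑ j ∈ Finset.range (n + 2), Real.cos (θ - 2 * Real.pi * j / (n + 2 : ℕ)) *
        (a k * a l * Real.cos (((k - l : ℤ) : ℝ) * (θ - 2 * Real.pi * j / (n + 2 : ℕ)))) =
      (if k + 1 = l then (n + 2 : ℕ) * (a k * a l) / 2 else 0) +
        (if l + 1 = k then (n + 2 : ℕ) * (a k * a l) / 2 else 0) := by
    intro k hk l hl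
    rw [Finset.mem_range] at hk hl
    have h1 := sum_cos_eq_ite (N := n + 2) (k - l + 1 : ℤ)
      (by rw [abs_lt]; constructor <;> push_cast <;> omega) θ
    have h2 := sum_cos_eq_ite (N := n + 2) (k - l - 1 : ℤ)
      (by rw [abs_lt]; constructor <;> push_cast <;> omega) θ
    have h3 : ∀ j : ℕ, Real.cos (θ - 2 * Real.pi * j / (n + 2 : ℕ)) *
        (a k * a l * Real.cos (((k - l : ℤ) : ℝ) * (θ - 2 * Real.pi * j / (n + 2 : ℕ)))) =
        a k * a l / 2 *
          (Real.cos (((k - l + 1 : ℤ) : ℝ) * (θ - 2 * Real.pi * j / (n + 2 : ℕ))) +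
          Real.cos (((k - l - 1 : ℤ) : ℝ) * (θ - 2 * Real.pi * j / (n + 2 : ℕ)))) := by
      intro j
      generalize θ - 2 * Real.pi * j / (n + 2 : ℕ) = t
      rw [Int.cast_add (k - l : ℤ), Int.cast_sub (k - l : ℤ), Int.cast_one, add_mul, sub_mul,
        one_mul, Real.cos_add, Real.cos_sub]
      ring
    simp_rw [h3]
    rw [← Finset.mul_sum, Finset.sum_add_distrib, h1, h2]
    rw [mul_add]
    congr 1 <;> split_ifs <;> first | (exfalso; omega) | ring
  have hside : ∀ k ∈ Finset.range (n + 1), ∑ l ∈ Finset.range (n + 1),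
      (if k + 1 = l then (n + 2 : ℕ) * (a k * a l) / 2 else 0) =
        (n + 2 : ℕ) * (a k * a (k + 1)) / 2 := by
    intro k hk
    rw [Finset.sum_ite_eq]
    split_ifs with h
    · rfl
    · obtain rfl : k = n := by simp at hk h; omega
      simp [ha]
  simp_rw [trigKernel, Finset.mul_sum]
  rw [Finset.sum_comm]
  simp_rw [Finset.sum_comm (s := Finset.range (n + 2))]
  rw [Finset.sum_congr rfl fun k hk => Finset.sum_congr rfl fun l hl => key k hk l hl]
  simp_rw [Finset.sum_add_distrib]
  rw [Finset.sum_congr rfl hside, Finset.sum_comm (s := Finset.range (n + 1)),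
    ← Finset.sum_add_distrib]
  refine Finset.sum_congr rfl fun k hk => ?_
  have h := hside k hk
  simp_rw [mul_comm (a _) (a k)]
  rw [h]
  ring

theorem parabola_sums (n : ℕ) :
    0 < ∑ k ∈ Finset.range (n + 1), (((k : ℝ) + 1) * (n + 1 - k)) ^ 2 ∧
    2 * (∑ k ∈ Finset.range (n + 1), (((k : ℝ) + 1) * (n + 1 - k)) ^ 2 -
      ∑ k ∈ Finset.range (n + 1),
        (((k : ℝ) + 1) * (n + 1 - k)) * ((((k + 1 : ℕ) : ℝ) + 1) * (n + 1 - (k + 1 : ℕ)))) *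
        ((n + 2) ^ 2 + 1) =
      10 * ∑ k ∈ Finset.range (n + 1), (((k : ℝ) + 1) * (n + 1 - k)) ^ 2 := by
  have h1 : ∀ (y : ℝ) (i : ℕ), ∑ k ∈ Finset.range i, (((k : ℝ) + 1) * (y - k)) ^ 2 =
      (i:ℝ) * (i + 1) * (2 * i + 1) / 6 * (y + 1) ^ 2 - 2 * (y + 1) * (i * (i + 1) / 2) ^ 2
        + (i:ℝ) * (i + 1) * (2 * i + 1) * (3 * i ^ 2 + 3 * i - 1) / 30 := by
    intro y i
    induction i with
    | zero => simp
    | succ i ih => rw [Finset.sum_range_succ, ih]; push_cast; ring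
  have h2 : ∀ (y : ℝ) (i : ℕ), ∑ k ∈ Finset.range i, (((k : ℝ) + 1) * (y - k)) *
        ((((k + 1 : ℕ) : ℝ) + 1) * (y - (k + 1 : ℕ))) =
      ∑ k ∈ Finset.range i, (((k : ℝ) + 1) * (y - k)) ^ 2 +
       (y * (i * (i + 1) / 2 * (y + 1) - i * (i + 1) * (2 * i + 1) / 6) -
        (i * (i + 1) * (2 * i + 1) / 6 * 2 * (y + 1) - 2 * (i * (i + 1) / 2) ^ 2)) := by
    intro y i
    induction i with
    | zero => simp
    | succ i ih =>
      rw [Finset.sum_range_succ, ih, Finset.sum_range_succ]; push_cast; ring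
  refine ⟨?_, ?_⟩
  · refine Finset.sum_pos (fun k hk => ?_) (by simp)
    have : (k : ℝ) < n + 1 := by exact_mod_cast Finset.mem_range.1 hk
    have : 0 < (n : ℝ) + 1 - k := by linarith
    positivity
  · rw [h2, h1]; push_cast; ring

theorem exists_polynomial_near_of_lipschitz (n : ℕ) {f : ℝ → ℝ} {L : ℝ}
    (hf : ∀ x ∈ Set.Icc (-1 : ℝ) 1, ∀ y ∈ Set.Icc (-1 : ℝ) 1, |f x - f y| ≤ L * |x - y|) :
    ∃ p : Polynomial ℝ, p.natDegree ≤ n ∧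
      ∀ x ∈ Set.Icc (-1 : ℝ) 1, |f x - p.eval x| ≤ L * (4 / (n + 2)) := by
  have hL : 0 ≤ L := by
    have h := (abs_nonneg _).trans (hf 1 (by norm_num) (-1) (by norm_num))
    norm_num at h
    exact h
  set a : ℕ → ℝ := fun k => ((k : ℝ) + 1) * (n + 1 - k) with ha
  set S := ∑ k ∈ Finset.range (n + 1), a k ^ 2 with hS
  set R := ∑ k ∈ Finset.range (n + 1), a k * a (k + 1) with hR
  obtain ⟨hSpos, hSR⟩ : 0 < S ∧ 2 * (S - R) * ((n + 2) ^ 2 + 1) = 10 * S := parabola_sums n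
  have han : a (n + 1) = 0 := by simp [ha]
  set φ : ℕ → ℝ := fun j => 2 * Real.pi * j / (n + 2 : ℕ) with hφ
  have hN : (0 : ℝ) < (n + 2 : ℕ) := by positivity
  have hN' : (0 : ℝ) < (n : ℝ) + 2 := by positivity
  set c : ℝ := ((n + 2 : ℕ) * S)⁻¹ with hc
  have hc0 : 0 < c := by positivity
  set P : ℝ → ℝ := fun θ => ∑ j ∈ Finset.range (n + 2),
    c * trigKernel a n (θ - φ j) * f (Real.cos (φ j)) with hP
  have hmem : ∀ t, Real.cos t ∈ Set.Icc (-1 : ℝ) 1 := Real.cos_mem_Icc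
  have hsum1 : ∀ θ, ∑ j ∈ Finset.range (n + 2), c * trigKernel a n (θ - φ j) = 1 := by
    intro θ
    rw [← Finset.mul_sum, sum_trigKernel, hc, inv_mul_cancel₀ (by positivity)]
  have hsum2 : ∀ θ, ∑ j ∈ Finset.range (n + 2),
      c * trigKernel a n (θ - φ j) * Real.cos (θ - φ j) = R / S := by
    intro θ
    simp_rw [mul_assoc, mul_comm (trigKernel _ _ _)]
    rw [← Finset.mul_sum, sum_cos_mul_trigKernel a n han, hc]
    field_simp
    rfl
  have hnode : ∀ θ ψ : ℝ, |f (Real.cos θ) - f (Real.cos ψ)| ≤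
      L * ((2 - 2 * Real.cos (θ - ψ)) * (n + 2) / 8 + 2 / (n + 2)) := by
    intro θ ψ
    refine (hf _ (hmem θ) _ (hmem ψ)).trans (mul_le_mul_of_nonneg_left ?_ hL)
    have h1 : |Real.cos θ - Real.cos ψ| ^ 2 ≤ 2 - 2 * Real.cos (θ - ψ) := by
      rw [sq_abs, Real.cos_sub]
      nlinarith [sq_nonneg (Real.sin θ - Real.sin ψ), Real.sin_sq_add_cos_sq θ,
        Real.sin_sq_add_cos_sq ψ]
    set d := |Real.cos θ - Real.cos ψ|
    have h2 : d ≤ d ^ 2 * (n + 2) / 8 + 2 / (n + 2) := by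
      rw [div_add_div _ _ (by norm_num) hN'.ne', le_div_iff₀ (by positivity)]
      nlinarith [sq_nonneg (d * (n + 2) - 4)]
    refine h2.trans ?_
    gcongr
  have hPerr : ∀ θ, |f (Real.cos θ) - P θ| ≤ L * (4 / (n + 2)) := by
    intro θ
    have h1 : f (Real.cos θ) - P θ = ∑ j ∈ Finset.range (n + 2),
        c * trigKernel a n (θ - φ j) * (f (Real.cos θ) - f (Real.cos (φ j))) := by
      simp_rw [mul_sub]
      rw [Finset.sum_sub_distrib, ← Finset.sum_mul, hsum1, one_mul]
    rw [h1]
    calc _ ≤ ∑ j ∈ Finset.range (n + 2), c * trigKernel a n (θ - φ j) *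
          (L * ((2 - 2 * Real.cos (θ - φ j)) * (n + 2) / 8 + 2 / (n + 2))) := by
          refine (Finset.abs_sum_le_sum_abs _ _).trans (Finset.sum_le_sum fun j _ => ?_)
          have hk : 0 ≤ c * trigKernel a n (θ - φ j) :=
            mul_nonneg hc0.le (trigKernel_nonneg _ _ _)
          rw [abs_mul, abs_of_nonneg hk]
          exact mul_le_mul_of_nonneg_left (hnode _ _) hk
      _ = L * ((n + 2) / 4 + 2 / (n + 2)) *
            ∑ j ∈ Finset.range (n + 2), c * trigKernel a n (θ - φ j) -
          L * ((n + 2) / 4) * ∑ j ∈ Finset.range (n + 2),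
            c * trigKernel a n (θ - φ j) * Real.cos (θ - φ j) := by
          rw [Finset.mul_sum, Finset.mul_sum, ← Finset.sum_sub_distrib]
          refine Finset.sum_congr rfl fun j _ => ?_
          ring
      _ = L * (2 * (S - R) * (n + 2) / (8 * S) + 2 / (n + 2)) := by
          rw [hsum1, hsum2]
          field_simp
          ring
      _ ≤ L * (4 / (n + 2)) := by
          refine mul_le_mul_of_nonneg_left ?_ hL
          have h2 : 2 * (S - R) = 10 * S / ((n + 2) ^ 2 + 1) := by
            rw [eq_div_iff (by positivity)]; exact hSR
          rw [h2]
          have h3 : 10 * S / ((n + 2) ^ 2 + 1) * (n + 2) / (8 * S) =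
              (10 / 8) * ((n + 2 : ℝ) / ((n + 2) ^ 2 + 1)) := by field_simp
          have h4 : (n + 2 : ℝ) / ((n + 2) ^ 2 + 1) ≤ 1 / (n + 2) := by
            rw [div_le_div_iff₀ (by positivity) hN']
            nlinarith
          have h5 : (0 : ℝ) < 1 / (n + 2) := by positivity
          rw [h3, show (4 : ℝ) / (n + 2) = 4 * (1 / (n + 2)) by ring,
            show (2 : ℝ) / (n + 2) = 2 * (1 / (n + 2)) by ring]
          linarith
  refine ⟨∑ j ∈ Finset.range (n + 2), ∑ k ∈ Finset.range (n + 1), ∑ l ∈ Finset.range (n + 1),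
    Polynomial.C (c * f (Real.cos (φ j)) * (a k * a l) * Real.cos (((k - l : ℤ) : ℝ) * φ j)) *
      Polynomial.Chebyshev.T ℝ (k - l), ?_, ?_⟩
  · refine Polynomial.natDegree_sum_le_of_forall_le _ _ fun j _ =>
      Polynomial.natDegree_sum_le_of_forall_le _ _ fun k hk =>
      Polynomial.natDegree_sum_le_of_forall_le _ _ fun l hl => ?_
    refine (Polynomial.natDegree_C_mul_le _ _).trans ?_
    rw [Polynomial.Chebyshev.natDegree_T]
    rw [Finset.mem_range] at hk hl
    omega
  · intro x hx
    obtain ⟨θ, rfl⟩ : ∃ θ, Real.cos θ = x := ⟨Real.arccos x, Real.cos_arccos hx.1 hx.2⟩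
    have hev : (∑ j ∈ Finset.range (n + 2), ∑ k ∈ Finset.range (n + 1),
        ∑ l ∈ Finset.range (n + 1), Polynomial.C
          (c * f (Real.cos (φ j)) * (a k * a l) * Real.cos (((k - l : ℤ) : ℝ) * φ j)) *
        Polynomial.Chebyshev.T ℝ (k - l)).eval (Real.cos θ) = (P θ + P (-θ)) / 2 := by
      simp only [hP, Polynomial.eval_finsetSum, Polynomial.eval_mul, Polynomial.eval_C,
        Polynomial.Chebyshev.T_real_cos, trigKernel]
      rw [← Finset.sum_add_distrib, Finset.sum_div]
      refine Finset.sum_congr rfl fun j _ => ?_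
      rw [← add_mul, ← mul_add, ← Finset.sum_add_distrib, Finset.mul_sum, Finset.sum_mul,
        Finset.sum_div]
      refine Finset.sum_congr rfl fun k _ => ?_
      rw [← Finset.sum_add_distrib, Finset.mul_sum, Finset.sum_mul, Finset.sum_div]
      refine Finset.sum_congr rfl fun l _ => ?_
      generalize (((k : ℤ) - l : ℤ) : ℝ) = z
      rw [mul_sub, mul_sub, mul_neg, Real.cos_sub, Real.cos_sub, Real.cos_neg, Real.sin_neg]
      ring
    rw [hev]
    have h1 := hPerr θ
    have h2 := hPerr (-θ)
    rw [Real.cos_neg] at h2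
    rw [abs_le] at h1 h2 ⊢
    constructor <;> linarith

theorem exists_polynomial_derivative_eq (q : Polynomial ℝ) :
    ∃ Q : Polynomial ℝ, Polynomial.derivative Q = q ∧ Q.natDegree ≤ q.natDegree + 1 := by
  refine ⟨∑ i ∈ Finset.range (q.natDegree + 1),
    Polynomial.monomial (i + 1) (q.coeff i / (i + 1)), ?_, ?_⟩
  · rw [Polynomial.derivative_sum]
    conv_rhs => rw [q.as_sum_range]
    refine Finset.sum_congr rfl fun i _ => ?_
    rw [Polynomial.derivative_monomial]
    have : ((i : ℝ) + 1) ≠ 0 := by positivity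
    simp [this]
  · refine Polynomial.natDegree_sum_le_of_forall_le _ _ fun i hi => ?_
    refine (Polynomial.natDegree_monomial_le _).trans ?_
    rw [Finset.mem_range] at hi
    omega

theorem exists_polynomial_near_of_iteratedDeriv_bound (N k : ℕ) {f : ℝ → ℝ} {M : ℝ} {U : Set ℝ}
    (hU : IsOpen U) (hUI : Set.Icc (-1 : ℝ) 1 ⊆ U) (hf : ContDiffOn ℝ (⊤ : ℕ∞) f U)
    (hM : ∀ x ∈ Set.Icc (-1 : ℝ) 1, |iteratedDeriv k f x| ≤ M) :
    ∃ p : Polynomial ℝ, p.natDegree ≤ N + k ∧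
      ∀ x ∈ Set.Icc (-1 : ℝ) 1, |f x - p.eval x| ≤ M * (4 / (N + 2)) ^ k := by
  induction k generalizing f with
  | zero => exact ⟨0, by simp, fun x hx => by simpa using hM x hx⟩
  | succ k ih =>
    rw [iteratedDeriv_succ'] at hM
    obtain ⟨q, hqd, hq⟩ := ih (hf.deriv_of_isOpen hU (by simp)) hM
    obtain ⟨Q, hQ, hQd⟩ := exists_polynomial_derivative_eq q
    set ε := M * (4 / (N + 2 : ℝ)) ^ k with hε
    have hε0 : 0 ≤ ε := (abs_nonneg _).trans (hq 0 (by norm_num))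
    have hlip : ∀ x ∈ Set.Icc (-1 : ℝ) 1, ∀ y ∈ Set.Icc (-1 : ℝ) 1,
        |(f x - Q.eval x) - (f y - Q.eval y)| ≤ ε * |x - y| := by
      intro x hx y hy
      refine Convex.norm_image_sub_le_of_norm_hasDerivWithin_le
        (f := fun z => f z - Q.eval z) (f' := fun z => deriv f z - q.eval z)
        (fun z hz => ?_) hq (convex_Icc _ _) hy hx
      have h1 : HasDerivAt f (deriv f z) z :=
        ((hf.differentiableOn (by simp)).differentiableAt (hU.mem_nhds (hUI hz))).hasDerivAt
      have h2 := Q.hasDerivAt z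
      rw [hQ] at h2
      exact (h1.sub h2).hasDerivWithinAt
    obtain ⟨r, hrd, hr⟩ := exists_polynomial_near_of_lipschitz (N + (k + 1)) hlip
    refine ⟨Q + r, ?_, fun x hx => ?_⟩
    · exact (Polynomial.natDegree_add_le _ _).trans (max_le (by omega) hrd)
    · rw [Polynomial.eval_add, ← sub_sub, pow_succ, ← mul_assoc]
      refine (hr x hx).trans (mul_le_mul_of_nonneg_left ?_ hε0)
      gcongr
      simp

theorem two_pow_mul_factorial_le (k : ℕ) : (2 : ℝ) ^ k * k.factorial ≤ 2 * (k : ℝ) ^ k := by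
  induction k with
  | zero => norm_num
  | succ k ih =>
    rcases Nat.eq_zero_or_pos k with rfl | hk
    · norm_num
    have h : 2 * (k : ℝ) ^ k ≤ (k + 1) ^ k := by
      have hk' : (0 : ℝ) < k := by exact_mod_cast hk
      have h1 := one_add_mul_le_pow (a := (1 / k : ℝ)) (by
        have : (0 : ℝ) < 1 / k := by positivity
        linarith) k
      have h2 : ((k : ℝ) + 1) ^ k = k ^ k * (1 + 1 / k) ^ k := by
        rw [← mul_pow]; congr 1; field_simp
      rw [h2, mul_comm]
      gcongr
      refine le_trans (le_of_eq ?_) h1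
      field_simp
      norm_num
    rw [Nat.factorial_succ]
    push_cast
    have h3 : (0 : ℝ) < k + 1 := by positivity
    calc (2 : ℝ) ^ (k + 1) * ((k + 1) * k.factorial)
        = 2 * (k + 1) * (2 ^ k * k.factorial) := by ring
      _ ≤ 2 * (k + 1) * (2 * (k : ℝ) ^ k) := by gcongr
      _ ≤ 2 * (k + 1) * ((k + 1) ^ k) := by gcongr
      _ = 2 * (k + 1) ^ (k + 1) := by ring

theorem factorial_le_of_le_div_add_one {s a : ℝ} (hs : 1 ≤ s) (ha : 0 < a) {k : ℕ}
    (hk : (k : ℝ) ≤ s / a + 1) :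
    (k.factorial : ℝ) ≤ 2 * Real.exp (1 + a) * (s / (2 * a)) ^ k := by
  have hs0 : 0 < s := by linarith
  have h1 : (k : ℝ) ≤ s / a * Real.exp (a / s) := by
    have h2 : s / a + 1 = s / a * (a / s + 1) := by
      field_simp
      ring
    rw [h2] at hk
    refine hk.trans ?_
    gcongr
    exact Real.add_one_le_exp _
  have h3 : (k : ℝ) * (a / s) ≤ 1 + a := by
    calc (k : ℝ) * (a / s) ≤ (s / a + 1) * (a / s) := by gcongr
      _ = 1 + a / s := by field_simp
      _ ≤ 1 + a := by
        have := div_le_self ha.le hs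
        linarith
  have h4 : (k : ℝ) ^ k ≤ (s / a) ^ k * Real.exp (1 + a) := by
    calc (k : ℝ) ^ k ≤ (s / a * Real.exp (a / s)) ^ k := by gcongr
      _ = (s / a) ^ k * Real.exp (k * (a / s)) := by rw [mul_pow, ← Real.exp_nat_mul]
      _ ≤ (s / a) ^ k * Real.exp (1 + a) := by gcongr
  have h5 : (s / (2 * a)) ^ k = (s / a) ^ k / 2 ^ k := by
    rw [← div_pow]; congr 1; field_simp
  rw [h5, ← mul_div_assoc, le_div_iff₀ (by positivity)]
  linarith [two_pow_mul_factorial_le k]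

theorem one_le_rho {r : ℝ} (hr : 0 ≤ r) : 1 ≤ rho r := by
  have : 1 ≤ Real.sqrt (1 + r ^ 2) := Real.one_le_sqrt.2 (by nlinarith)
  unfold rho
  linarith

theorem rho_le_exp {r : ℝ} (hr : 0 ≤ r) : rho r ≤ Real.exp r := by
  rw [rho, ← Real.exp_arsinh, Real.exp_le_exp, ← Real.sinh_le_sinh, Real.sinh_arsinh]
  exact Real.self_le_sinh_iff.2 hr

theorem rho_le_three_mul {r : ℝ} (hr : 1 ≤ r) : rho r ≤ 3 * r := by
  have : Real.sqrt (1 + r ^ 2) ≤ 1 + r :=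
    Real.sqrt_le_iff.2 ⟨by linarith, by nlinarith⟩
  unfold rho
  linarith

theorem seven_le_exp_two : (7 : ℝ) ≤ Real.exp 2 := by
  have h : Real.exp 2 = Real.exp 1 * Real.exp 1 := by rw [← Real.exp_add]; norm_num
  rw [h]
  nlinarith [Real.exp_one_gt_d9]

theorem div_three_mul_max_le_rho_rpow {A : ℝ} (hA : 0 < A) :
    A / (3 * max 1 A) ≤ rho (1 / A) ^ (-(7 * max 1 A) / Real.exp 2) := by
  have hr : 0 ≤ 1 / A := by positivity
  have hρ := one_le_rho hr
  have he := Real.exp_pos 2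
  have hmax : 0 < max 1 A := by positivity
  rw [neg_div, Real.rpow_neg (by linarith)]
  refine (le_inv_comm₀ (by positivity) (by positivity)).2 ?_
  rw [inv_div]
  rcases le_total A 1 with h | h
  · rw [max_eq_left h, mul_one, mul_one]
    calc rho (1 / A) ^ (7 / Real.exp 2) ≤ rho (1 / A) ^ (1 : ℝ) :=
          Real.rpow_le_rpow_of_exponent_le hρ ((div_le_one he).2 seven_le_exp_two)
      _ = rho (1 / A) := Real.rpow_one _
      _ ≤ 3 * (1 / A) := rho_le_three_mul ((one_le_div hA).2 h)
      _ = 3 / A := by ring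
  · rw [max_eq_right h, mul_div_cancel_right₀ _ hA.ne']
    calc rho (1 / A) ^ (7 * A / Real.exp 2) ≤ Real.exp (1 / A) ^ (7 * A / Real.exp 2) :=
          Real.rpow_le_rpow (by linarith) (rho_le_exp hr) (by positivity)
      _ = Real.exp (7 / Real.exp 2) := by rw [← Real.exp_mul]; congr 1; field_simp
      _ ≤ Real.exp 1 := Real.exp_le_exp.2 ((div_le_one he).2 seven_le_exp_two)
      _ ≤ 3 := Real.exp_one_lt_three.le

/-- There is `C : (0,∞)×[1,∞) → (0,∞)`, monotonically increasing in its first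
argument, such that for all `δ ≥ 1`, `C_G, A > 0`, all
`f ∈ G^δ([-1,1], C_G, A)` and all integers `m ≥ 3`, the best uniform polynomial
approximation of degree `m` satisfies
`min_{p ∈ 𝒫_m} ‖f - p‖_{C([-1,1])} ≤ C(A,δ)·C_G·ρ(1/A)^{-m^{1/δ}/e²}`. -/
theorem stmt0 :
    ∃ C : ℝ → ℝ → ℝ,
      (∀ A δ : ℝ, 0 < A → 1 ≤ δ → 0 < C A δ) ∧
      (∀ A₁ A₂ δ : ℝ, 0 < A₁ → A₁ ≤ A₂ → 1 ≤ δ → C A₁ δ ≤ C A₂ δ) ∧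
      ∀ δ CG A : ℝ, 1 ≤ δ → 0 < CG → 0 < A →
        ∀ f : ℝ → ℝ, GevreyOn (-1) 1 δ CG A f →
          ∀ m : ℕ, 3 ≤ m →
            ∃ p : Polynomial ℝ, p.natDegree ≤ m ∧
              ∀ x ∈ Set.Icc (-1 : ℝ) 1,
                |f x - p.eval x| ≤
                  C A δ * CG * rho (1 / A) ^ (-(m : ℝ) ^ (1 / δ) / Real.exp 2) := by
  have hbase : ∀ A : ℝ, 0 < 2 * Real.exp (1 + 7 * max 1 A) := fun A => by positivity
  refine ⟨fun A δ => (2 * Real.exp (1 + 7 * max 1 A)) ^ δ,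
    fun A δ _ _ => Real.rpow_pos_of_pos (hbase A) δ, fun A₁ A₂ δ _ h12 hδ => ?_, ?_⟩
  · refine Real.rpow_le_rpow (hbase A₁).le ?_ (by linarith)
    gcongr
  intro δ CG A hδ hCG hA f hf m hm
  obtain ⟨⟨U, hU, hUI, hfU⟩, hbound⟩ := hf
  have hδ0 : 0 < δ := by linarith
  have hm3 : (3 : ℝ) ≤ m := by exact_mod_cast hm
  have hm0 : (0 : ℝ) < m := by linarith
  set μ := max 1 A with hμ
  have hμ1 : 1 ≤ μ := le_max_left _ _
  set a := 7 * μ with ha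
  have ha7 : 7 ≤ a := by linarith
  have ha0 : 0 < a := by linarith
  set s := (m : ℝ) ^ (1 / δ) with hs
  have hs1 : 1 ≤ s := Real.one_le_rpow (by linarith) (by positivity)
  have hsm : s ≤ m := by
    calc s ≤ (m : ℝ) ^ (1 : ℝ) :=
          Real.rpow_le_rpow_of_exponent_le (by linarith) ((div_le_one hδ0).2 hδ)
      _ = m := Real.rpow_one _
  have hsδ : s ^ δ = m := by
    rw [hs, ← Real.rpow_mul hm0.le, one_div_mul_cancel hδ0.ne', Real.rpow_one]
  set k := ⌈s / a⌉₊ with hk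
  have hk1 : s / a ≤ k := Nat.le_ceil _
  have hk2 : (k : ℝ) ≤ s / a + 1 := (Nat.ceil_lt_add_one (by positivity)).le
  have hsa : s / a ≤ m / 7 := by gcongr
  have hkm : k ≤ m := by
    have : (k : ℝ) ≤ m := by linarith
    exact_mod_cast this
  obtain ⟨p, hpd, hp⟩ := exists_polynomial_near_of_iteratedDeriv_bound (m - k) k hU hUI hfU
    (hbound k)
  refine ⟨p, by omega, fun x hx => (hp x hx).trans ?_⟩
  have hN : 6 * (m : ℝ) / 7 ≤ ((m - k : ℕ) : ℝ) + 2 := by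
    rw [Nat.cast_sub hkm]
    linarith
  have hfact : (k.factorial : ℝ) ^ δ ≤ (2 * Real.exp (1 + a)) ^ δ * (m / (2 * a)) ^ k := by
    have h1 : (2 * a) ^ (1 : ℝ) ≤ (2 * a) ^ δ :=
      Real.rpow_le_rpow_of_exponent_le (by linarith) hδ
    rw [Real.rpow_one] at h1
    calc (k.factorial : ℝ) ^ δ
        ≤ (2 * Real.exp (1 + a) * (s / (2 * a)) ^ k) ^ δ :=
          Real.rpow_le_rpow (by positivity) (factorial_le_of_le_div_add_one hs1 ha0 hk2) hδ0.le
      _ = (2 * Real.exp (1 + a)) ^ δ * (m / (2 * a) ^ δ) ^ k := by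
          rw [Real.mul_rpow (by positivity) (by positivity), ← Real.rpow_natCast,
            ← Real.rpow_mul (by positivity), mul_comm (k : ℝ), Real.rpow_mul (by positivity),
            Real.rpow_natCast, Real.div_rpow (by positivity) (by positivity), hsδ]
      _ ≤ (2 * Real.exp (1 + a)) ^ δ * (m / (2 * a)) ^ k := by gcongr
  set q := A / (3 * μ) with hq
  have hq0 : 0 < q := by positivity
  have hq1 : q ≤ 1 := by
    rw [hq, div_le_one (by positivity)]
    linarith [le_max_right 1 A]
  have hratio : A * (m / (2 * a)) * (4 / (((m - k : ℕ) : ℝ) + 2)) ≤ q := by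
    calc A * (m / (2 * a)) * (4 / (((m - k : ℕ) : ℝ) + 2))
        ≤ A * (m / (2 * a)) * (4 / (6 * (m : ℝ) / 7)) := by gcongr
      _ = q := by
          rw [hq, ha]
          field_simp
          norm_num
  have hqk : q ^ k ≤ rho (1 / A) ^ (-s / Real.exp 2) := by
    have hρ : 0 ≤ rho (1 / A) := zero_le_one.trans (one_le_rho (by positivity))
    calc q ^ k = q ^ (k : ℝ) := (Real.rpow_natCast _ _).symm
      _ ≤ q ^ (s / a) := Real.rpow_le_rpow_of_exponent_ge hq0 hq1 hk1
      _ ≤ (rho (1 / A) ^ (-a / Real.exp 2)) ^ (s / a) :=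
          Real.rpow_le_rpow hq0.le (div_three_mul_max_le_rho_rpow hA) (by positivity)
      _ = rho (1 / A) ^ (-s / Real.exp 2) := by
          rw [← Real.rpow_mul hρ]
          congr 1
          field_simp
  calc CG * A ^ k * (k.factorial : ℝ) ^ δ * (4 / (((m - k : ℕ) : ℝ) + 2)) ^ k
      ≤ CG * A ^ k * ((2 * Real.exp (1 + a)) ^ δ * (m / (2 * a)) ^ k) *
          (4 / (((m - k : ℕ) : ℝ) + 2)) ^ k := by gcongr
    _ = (2 * Real.exp (1 + a)) ^ δ * CG *
          (A * (m / (2 * a)) * (4 / (((m - k : ℕ) : ℝ) + 2))) ^ k := by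
        rw [mul_pow, mul_pow]
        ring
    _ ≤ (2 * Real.exp (1 + a)) ^ δ * CG * q ^ k := by gcongr
    _ ≤ (2 * Real.exp (1 + a)) ^ δ * CG * rho (1 / A) ^ (-s / Real.exp 2) := by gcongr
end

section
/- Let ρ(r) = r + √(1 + r²). There exists a function C : (0,∞) × [1,∞) → (0,∞), monotonically increasing in its first argument, such that the following holds: let d ≥ 1, let Q = ∏_{i=1}^d [a_i, b_i] be an axis-parallel box with a_i < b_i, let m ≥ 3 be an integer, and for each coordinate i fix m+1 distinct nodes in [a_i, b_i] whose univariate Lagrange interpolation operator satisfies the sup-norm stability bound with constant Λ_m ≥ 1 on [a_i,b_i]; let 𝓘_m^Q be the tensor-product interpolation operator obtained by composing the coordinatewise Lagrange interpolations. Then for every δ ≥ 1, every C_G, A > 0, and every f of Gevrey class G^δ(Q, C_G, A), one has sup_{x ∈ Q} |f(x) − (𝓘_m^Q f)(x)| ≤ C(A·diam_∞(Q)/2, δ) · C_G · d · (Λ_m + 1)^d · ρ(2/(A·diam_∞(Q)))^{−m^{1/δ}/e²}. -/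
/-- The axis-parallel box `∏_i [a i, b i] ⊆ ℝ^d`. -/
def box {d : ℕ} (a b : Fin d → ℝ) : Set (Fin d → ℝ) :=
  {y | ∀ i, y i ∈ Set.Icc (a i) (b i)}

/-- The `ℓ^∞`-diameter of the box `∏_i [a i, b i]`, i.e. `max_i (b i - a i)`. -/
noncomputable def diamInf {d : ℕ} (a b : Fin d → ℝ) : ℝ := ⨆ i, (b i - a i)

/-- The partial derivative in coordinate `i` of `f : ℝ^d → ℝ`. -/
noncomputable def pderiv' {d : ℕ} (i : Fin d) (f : (Fin d → ℝ) → ℝ) :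
    (Fin d → ℝ) → ℝ :=
  fun y => deriv (fun t => f (Function.update y i t)) (y i)

/-- The mixed partial derivative `∂^α f` for a multi-index `α ∈ ℕ^d`. -/
noncomputable def mderiv {d : ℕ} (α : Fin d → ℕ) :
    ((Fin d → ℝ) → ℝ) → ((Fin d → ℝ) → ℝ) :=
  (List.ofFn fun i : Fin d => (pderiv' i)^[α i]).foldr (· ∘ ·) id

/-- `f : ℝ^d → ℝ` is of Gevrey class `G^δ(Q, C_G, A)` on the box
`Q = ∏_i [a i, b i]`: it is `C^∞` on a neighborhood of `Q` and
`|∂^α f(y)| ≤ C_G·A^{|α|}·(α!)^δ` on `Q` for all multi-indices `α`. -/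
def GevreyOnBox {d : ℕ} (a b : Fin d → ℝ) (δ CG A : ℝ)
    (f : (Fin d → ℝ) → ℝ) : Prop :=
  (∃ U : Set (Fin d → ℝ), IsOpen U ∧ box a b ⊆ U ∧ ContDiffOn ℝ (⊤ : ℕ∞) f U) ∧
    ∀ α : Fin d → ℕ, ∀ y ∈ box a b,
      |mderiv α f y| ≤ CG * A ^ (∑ i, α i) *
        ((∏ i, (α i).factorial : ℕ) : ℝ) ^ δ

/-- Univariate Lagrange interpolation applied in coordinate `i`, with the other
variables frozen. -/
noncomputable def coordInterp {d m : ℕ} (nodes : Fin d → Fin (m + 1) → ℝ)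
    (i : Fin d) (f : (Fin d → ℝ) → ℝ) : (Fin d → ℝ) → ℝ :=
  fun y => (Lagrange.interpolate Finset.univ (nodes i)
    (fun j => f (Function.update y i (nodes i j)))).eval (y i)

/-- The tensor-product interpolation operator
`𝓘_m^Q = 𝓘_{m,1} ∘ ⋯ ∘ 𝓘_{m,d}`. -/
noncomputable def tensorInterp {d m : ℕ} (nodes : Fin d → Fin (m + 1) → ℝ) :
    ((Fin d → ℝ) → ℝ) → ((Fin d → ℝ) → ℝ) :=
  (List.ofFn fun i : Fin d => coordInterp nodes i).foldr (· ∘ ·) id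

/-- The `n`-th Chebyshev coefficient of a function on `[-1, 1]`. -/
noncomputable def chebCoeff (h : ℝ → ℝ) (n : ℤ) : ℝ :=
  (1 / Real.pi) * ∫ θ in (0 : ℝ)..(2 * Real.pi), h (Real.cos θ) * Real.cos (n * θ)

theorem abs_chebCoeff_le {h : ℝ → ℝ} {M : ℝ} (hM : ∀ x ∈ Set.Icc (-1 : ℝ) 1, |h x| ≤ M) (n : ℤ) :
    |chebCoeff h n| ≤ 2 * M := by
  have hpi := Real.pi_pos
  have key : ‖∫ θ in (0 : ℝ)..(2 * Real.pi), h (Real.cos θ) * Real.cos (n * θ)‖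
      ≤ M * |2 * Real.pi - 0| := by
    apply intervalIntegral.norm_integral_le_of_norm_le_const
    intro θ _
    rw [norm_mul, Real.norm_eq_abs, Real.norm_eq_abs]
    have h1 := hM (Real.cos θ) (Real.cos_mem_Icc θ)
    have h2 := Real.abs_cos_le_one (n * θ)
    have h3 := abs_nonneg (h (Real.cos θ))
    have h4 := abs_nonneg (Real.cos (n * θ))
    nlinarith
  rw [Real.norm_eq_abs, sub_zero, abs_of_pos (by positivity : 0 < 2 * Real.pi)] at key
  rw [chebCoeff, abs_mul, abs_of_pos (by positivity : 0 < 1 / Real.pi)]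
  calc 1 / Real.pi * _ ≤ 1 / Real.pi * (M * (2 * Real.pi)) := by gcongr
    _ = 2 * M := by field_simp

theorem mul_chebCoeff {h h' : ℝ → ℝ}
    (hd : ∀ x ∈ Set.Icc (-1 : ℝ) 1, HasDerivAt h (h' x) x)
    (hc : Continuous fun θ => h' (Real.cos θ)) (n : ℤ) :
    (n : ℝ) * chebCoeff h n = (chebCoeff h' (n - 1) - chebCoeff h' (n + 1)) / 2 := by
  have hibp := intervalIntegral.integral_mul_deriv_eq_deriv_mul (a := 0) (b := 2 * Real.pi)
    (u := fun θ => h (Real.cos θ)) (u' := fun θ => h' (Real.cos θ) * (-Real.sin θ))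
    (v := fun θ => Real.sin (n * θ)) (v' := fun θ => Real.cos (n * θ) * n)
    (fun θ _ => (hd _ (Real.cos_mem_Icc θ)).comp θ (Real.hasDerivAt_cos θ))
    (fun θ _ => by
      have := (Real.hasDerivAt_sin (n * θ)).comp θ ((hasDerivAt_id θ).const_mul (n : ℝ))
      simpa [Function.comp_def] using this)
    ((hc.mul (by fun_prop)).intervalIntegrable _ _)
    (Continuous.intervalIntegrable (by fun_prop) _ _)
  have hs : Real.sin (n * (2 * Real.pi)) = 0 := by
    have := Real.sin_int_mul_pi (n * 2)
    push_cast at this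
    rw [← this]; ring_nf
  simp only [hs, mul_zero, Real.sin_zero, sub_zero, zero_sub] at hibp
  have e1 : (∫ θ in (0 : ℝ)..(2 * Real.pi), h (Real.cos θ) * (Real.cos (n * θ) * n))
      = n * ∫ θ in (0 : ℝ)..(2 * Real.pi), h (Real.cos θ) * Real.cos (n * θ) := by
    rw [← intervalIntegral.integral_const_mul]
    congr 1; ext θ; ring
  have e2 : -(∫ θ in (0 : ℝ)..(2 * Real.pi), h' (Real.cos θ) * (-Real.sin θ) * Real.sin (n * θ))
      = ((∫ θ in (0 : ℝ)..(2 * Real.pi), h' (Real.cos θ) * Real.cos ((n - 1 : ℤ) * θ))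
        - ∫ θ in (0 : ℝ)..(2 * Real.pi), h' (Real.cos θ) * Real.cos ((n + 1 : ℤ) * θ)) / 2 := by
    have hi : ∀ c : ℤ, IntervalIntegrable (fun θ => h' (Real.cos θ) * Real.cos (c * θ))
        MeasureTheory.volume 0 (2 * Real.pi) := fun c =>
      (hc.mul (by fun_prop)).intervalIntegrable _ _
    rw [← intervalIntegral.integral_sub (hi _) (hi _), ← intervalIntegral.integral_neg,
      ← intervalIntegral.integral_div]
    congr 1; ext θ
    push_cast
    rw [sub_mul, add_mul, one_mul, Real.cos_sub, Real.cos_add]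
    ring
  rw [e1, e2] at hibp
  simp only [chebCoeff]
  linear_combination (1 / Real.pi) * hibp

theorem abs_chebCoeff_le_of_deriv {G : ℕ → ℝ → ℝ}
    (hd : ∀ k, ∀ x ∈ Set.Icc (-1 : ℝ) 1, HasDerivAt (G k) (G (k + 1) x) x)
    {M : ℕ → ℝ} (hM : ∀ k, ∀ x ∈ Set.Icc (-1 : ℝ) 1, |G k x| ≤ M k) {N : ℝ} (hN : 0 < N) (k : ℕ) :
    ∀ j : ℕ, ∀ n : ℤ, N + k ≤ n + 1 → |chebCoeff (G j) n| ≤ 2 * M (j + k) / N ^ k := by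
  induction k with
  | zero =>
    intro j n _
    simpa using abs_chebCoeff_le (hM j) n
  | succ k ih =>
    intro j n hn
    push_cast at hn
    have hk : (0 : ℝ) ≤ k := k.cast_nonneg
    have h1 := ih (j + 1) (n - 1) (by push_cast; linarith)
    have h2 := ih (j + 1) (n + 1) (by push_cast; linarith)
    have hcont : Continuous fun θ => G (j + 1) (Real.cos θ) :=
      continuous_iff_continuousAt.2 fun θ =>
        ((hd (j + 1) _ (Real.cos_mem_Icc θ)).continuousAt).comp Real.continuous_cos.continuousAt
    have h3 := mul_chebCoeff (hd j) hcont n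
    have hnN : N ≤ n := by linarith
    have h4 : (n : ℝ) * |chebCoeff (G j) n| ≤ 2 * M (j + 1 + k) / N ^ k := by
      rw [← abs_of_nonneg (hN.le.trans hnN), ← abs_mul, h3, abs_div, abs_two]
      have := abs_sub (chebCoeff (G (j + 1)) (n - 1)) (chebCoeff (G (j + 1)) (n + 1))
      linarith
    have h5 : N * |chebCoeff (G j) n| ≤ 2 * M (j + 1 + k) / N ^ k :=
      (mul_le_mul_of_nonneg_right hnN (abs_nonneg _)).trans h4
    rw [show j + (k + 1) = j + 1 + k by ring, pow_succ, ← div_div, le_div_iff₀ hN]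
    linarith

theorem hasSum_chebCoeff {h : ℝ → ℝ} (hc : Continuous fun θ => h (Real.cos θ))
    (hs : Summable fun n : ℕ => chebCoeff h n) (θ : ℝ) :
    HasSum (fun n : ℕ => chebCoeff h n * Real.cos (n * θ))
      (h (Real.cos θ) + chebCoeff h 0 / 2) := by
  have : Fact (0 < 2 * Real.pi) := ⟨Real.two_pi_pos⟩
  have hper : Function.Periodic (fun θ : ℝ => ((h (Real.cos θ) : ℝ) : ℂ)) (2 * Real.pi) := by
    intro x; simp
  have hcont : Continuous hper.lift :=
    continuous_coinduced_dom.mpr (Complex.continuous_ofReal.comp hc)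
  let F : C(AddCircle (2 * Real.pi), ℂ) := ⟨hper.lift, hcont⟩
  have hF : ∀ x : ℝ, F (x : AddCircle (2 * Real.pi)) = ((h (Real.cos x) : ℝ) : ℂ) := fun x => rfl
  have hodd : ∀ n : ℤ, ∫ x in (0 : ℝ)..(2 * Real.pi), h (Real.cos x) * Real.sin (n * x) = 0 := by
    intro n
    have h1 := intervalIntegral.integral_comp_sub_left (a := 0) (b := 2 * Real.pi)
      (fun x => h (Real.cos x) * Real.sin (n * x)) (2 * Real.pi)
    have h2 : ∀ x : ℝ, h (Real.cos (2 * Real.pi - x)) * Real.sin (n * (2 * Real.pi - x))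
        = -(h (Real.cos x) * Real.sin (n * x)) := by
      intro x
      rw [Real.cos_two_pi_sub, mul_sub, Real.sin_int_mul_two_pi_sub]
      ring
    simp only [h2, intervalIntegral.integral_neg, sub_zero, sub_self] at h1
    linarith
  have hcoef : ∀ n : ℤ, fourierCoeff F n = ((chebCoeff h n / 2 : ℝ) : ℂ) := by
    intro n
    rw [fourierCoeff_eq_intervalIntegral _ _ 0, zero_add]
    have e : ∀ x : ℝ, fourier (-n) (x : AddCircle (2 * Real.pi)) • F x
        = ((h (Real.cos x) * Real.cos (n * x) : ℝ) : ℂ)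
          - ((h (Real.cos x) * Real.sin (n * x) : ℝ) : ℂ) * Complex.I := by
      intro x
      rw [hF, fourier_coe_apply, smul_eq_mul]
      have : 2 * (Real.pi : ℂ) * Complex.I * ((-n : ℤ) : ℂ) * x / ((2 * Real.pi : ℝ) : ℂ)
          = ((-(n * x) : ℝ) : ℂ) * Complex.I := by
        have : (Real.pi : ℂ) ≠ 0 := by exact_mod_cast Real.pi_ne_zero
        push_cast; field_simp
      rw [this, Complex.exp_mul_I, ← Complex.ofReal_cos, ← Complex.ofReal_sin, Real.cos_neg,
        Real.sin_neg]
      push_cast; ring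
    simp only [e]
    rw [intervalIntegral.integral_sub, intervalIntegral.integral_mul_const,
      intervalIntegral.integral_ofReal, intervalIntegral.integral_ofReal, hodd n]
    · rw [chebCoeff, Complex.real_smul]
      push_cast; ring
    · exact (Complex.continuous_ofReal.comp (hc.mul (by fun_prop))).intervalIntegrable _ _
    · exact ((Complex.continuous_ofReal.comp (hc.mul (by fun_prop))).mul
        continuous_const).intervalIntegrable _ _
  have hneg : ∀ n : ℤ, chebCoeff h (-n) = chebCoeff h n := by
    intro n; simp [chebCoeff]
  have hsum : Summable (fourierCoeff F) := by
    have : Summable fun n : ℕ => ((chebCoeff h n / 2 : ℝ) : ℂ) :=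
      (Complex.summable_ofReal (f := fun n : ℕ => chebCoeff h n / 2)).2 (hs.div_const 2)
    apply Summable.of_nat_of_neg
    · simpa only [hcoef] using this
    · simpa only [hcoef, hneg] using this
  have key := has_pointwise_sum_fourier_series_of_summable hsum (θ : AddCircle (2 * Real.pi))
  have key2 := (Complex.hasSum_re key).nat_add_neg
  have hterm : ∀ n : ℤ, (fourierCoeff F n • fourier n (θ : AddCircle (2 * Real.pi))).re
      = chebCoeff h n / 2 * Real.cos (n * θ) := by
    intro n
    rw [hcoef, fourier_coe_apply, smul_eq_mul, Complex.re_ofReal_mul]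
    have : 2 * (Real.pi : ℂ) * Complex.I * (n : ℂ) * θ / ((2 * Real.pi : ℝ) : ℂ)
          = ((n * θ : ℝ) : ℂ) * Complex.I := by
      have : (Real.pi : ℂ) ≠ 0 := by exact_mod_cast Real.pi_ne_zero
      push_cast; field_simp
    rw [this, Complex.exp_ofReal_mul_I_re]
  simp only [hterm, hF, Complex.ofReal_re, hneg] at key2
  convert key2 using 1
  · ext n; push_cast; rw [neg_mul, Real.cos_neg]; ring
  · simp

theorem exists_polynomial_approx {G : ℕ → ℝ → ℝ}
    (hd : ∀ k, ∀ x ∈ Set.Icc (-1 : ℝ) 1, HasDerivAt (G k) (G (k + 1) x) x)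
    {M : ℕ → ℝ} (hM : ∀ k, ∀ x ∈ Set.Icc (-1 : ℝ) 1, |G k x| ≤ M k) {m k : ℕ} (hk : 2 ≤ k)
    (hkm : 2 * k ≤ m) :
    ∃ p : Polynomial ℝ, p.natDegree ≤ m ∧ ∀ x ∈ Set.Icc (-1 : ℝ) 1,
      |G 0 x - p.eval x| ≤ 2 * (M k * 2 ^ k / m ^ k) * m ^ 2 * ∑' n : ℕ, 1 / ((n : ℝ) + 1) ^ 2 := by
  have hM0 : 0 ≤ M k := (abs_nonneg _).trans (hM k 0 (by norm_num))
  have hm : (0 : ℝ) < m := by exact_mod_cast (by omega : 0 < m)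
  have hkm' : 2 * (k : ℝ) ≤ m := by exact_mod_cast hkm
  set D : ℝ := 2 * (M k * 2 ^ k / m ^ k) * m ^ 2 with hD
  have hD0 : 0 ≤ D := by positivity
  have hbound : ∀ i : ℕ, |chebCoeff (G 0) ((i + (m + 1) : ℕ) : ℤ)| ≤ D * (1 / ((i : ℝ) + 1) ^ 2) := by
    intro i
    have hi : (0 : ℝ) ≤ i := i.cast_nonneg
    set n : ℝ := (i : ℝ) + m + 1 with hn
    have h1 := abs_chebCoeff_le_of_deriv hd hM (N := n / 2) (by positivity) k 0
      ((i + (m + 1) : ℕ) : ℤ) (by push_cast; linarith)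
    rw [zero_add] at h1
    refine h1.trans ?_
    obtain ⟨l, rfl⟩ : ∃ l, k = l + 2 := ⟨k - 2, by omega⟩
    have h2 : (m : ℝ) ^ l * ((i : ℝ) + 1) ^ 2 ≤ n ^ (l + 2) := by
      rw [pow_add]
      gcongr <;> linarith
    calc 2 * M (l + 2) / (n / 2) ^ (l + 2) = 2 * M (l + 2) * 2 ^ (l + 2) / n ^ (l + 2) := by
          rw [div_pow]; field_simp
      _ ≤ 2 * M (l + 2) * 2 ^ (l + 2) / ((m : ℝ) ^ l * ((i : ℝ) + 1) ^ 2) := by gcongr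
      _ = D * (1 / ((i : ℝ) + 1) ^ 2) := by
          rw [hD, pow_add (m : ℝ)]; field_simp
  have hS : Summable fun n : ℕ => 1 / ((n : ℝ) + 1) ^ 2 := by
    have := (summable_nat_add_iff 1).2 (Real.summable_one_div_nat_pow.2 (by norm_num : 1 < 2))
    simpa using this
  have hs : Summable fun n : ℕ => chebCoeff (G 0) n := by
    rw [← summable_nat_add_iff (m + 1)]
    exact Summable.of_norm_bounded (hS.mul_left D) hbound
  have hcont : Continuous fun θ => G 0 (Real.cos θ) :=
    continuous_iff_continuousAt.2 fun θ =>
      ((hd 0 _ (Real.cos_mem_Icc θ)).continuousAt).comp Real.continuous_cos.continuousAt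
  refine ⟨Polynomial.C (-(chebCoeff (G 0) 0 / 2)) + ∑ n ∈ Finset.range (m + 1),
    Polynomial.C (chebCoeff (G 0) n) * Polynomial.Chebyshev.T ℝ n, ?_, ?_⟩
  · refine Polynomial.natDegree_add_le_of_degree_le (by simp) ?_
    refine Polynomial.natDegree_sum_le_of_forall_le _ _ fun n hn => ?_
    refine (Polynomial.natDegree_C_mul_le _ _).trans ?_
    rw [Polynomial.Chebyshev.natDegree_T, Int.natAbs_natCast]
    exact Nat.lt_succ_iff.1 (Finset.mem_range.1 hn)
  · intro x hx
    set θ := Real.arccos x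
    have hxθ : x = Real.cos θ := (Real.cos_arccos hx.1 hx.2).symm
    have hsum := hasSum_chebCoeff hcont hs θ
    have hsplit := hsum.summable.sum_add_tsum_nat_add (m + 1)
    rw [hsum.tsum_eq] at hsplit
    have herr : G 0 x - (Polynomial.C (-(chebCoeff (G 0) 0 / 2)) + ∑ n ∈ Finset.range (m + 1),
        Polynomial.C (chebCoeff (G 0) n) * Polynomial.Chebyshev.T ℝ n).eval x
        = ∑' i : ℕ, chebCoeff (G 0) ((i + (m + 1) : ℕ) : ℤ) * Real.cos ((i + (m + 1) : ℕ) * θ) := by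
      rw [hxθ]
      simp only [Polynomial.eval_add, Polynomial.eval_C, Polynomial.eval_finsetSum,
        Polynomial.eval_mul, Polynomial.Chebyshev.T_real_cos, Int.cast_natCast]
      linarith
    rw [herr, ← tsum_mul_left, ← Real.norm_eq_abs]
    refine tsum_of_norm_bounded (hS.mul_left D).hasSum fun i => ?_
    rw [norm_mul, Real.norm_eq_abs, Real.norm_eq_abs]
    exact (mul_le_of_le_one_right (abs_nonneg _) (Real.abs_cos_le_one _)).trans (hbound i)

theorem rho_pos {r : ℝ} (hr : 0 ≤ r) : 0 < rho r := by
  unfold rho; positivity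

theorem exp_le_rho_rpow {B t : ℝ} (hB : 0 < B) (ht : 0 ≤ t) :
    Real.exp (-t / B) ≤ rho (1 / B) ^ (-t) := by
  have h1 : rho (1 / B) ≤ Real.exp (1 / B) := by
    rw [rho, ← Real.exp_arsinh]
    gcongr
    rw [← Real.sinh_le_sinh, Real.sinh_arsinh, Real.self_le_sinh_iff]
    positivity
  calc Real.exp (-t / B) = Real.exp (1 / B) ^ (-t) := by
        rw [← Real.exp_mul]; ring_nf
    _ ≤ _ := Real.rpow_le_rpow_of_nonpos (rho_pos (by positivity)) h1 (by linarith)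

theorem rpow_le_rho_rpow {B t : ℝ} (hB : 0 < B) (hB2 : 2 * B ≤ 1) (ht : 0 ≤ t) :
    (2 * B / 5) ^ t ≤ rho (1 / B) ^ (-t) := by
  have h1 : rho (1 / B) ≤ (2 * B / 5)⁻¹ := by
    have hs : Real.sqrt (1 + (1 / B) ^ 2) ≤ 1 + 1 / B := by
      rw [Real.sqrt_le_left (by positivity)]
      have : 0 < 1 / B := by positivity
      nlinarith
    calc rho (1 / B) ≤ 1 / B + (1 + 1 / B) := by unfold rho; gcongr
      _ ≤ (2 * B / 5)⁻¹ := by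
        rw [inv_div, ← sub_nonneg]
        have : 5 / (2 * B) - (1 / B + (1 + 1 / B)) = (1 - 2 * B) / (2 * B) := by field_simp; ring
        rw [this]
        exact div_nonneg (by linarith) (by positivity)
  calc (2 * B / 5) ^ t = ((2 * B / 5)⁻¹) ^ (-t) := by
        rw [Real.inv_rpow (by positivity), Real.rpow_neg (by positivity), inv_inv]
    _ ≤ _ := Real.rpow_le_rpow_of_nonpos (rho_pos (by positivity)) h1 (by linarith)

theorem exists_rpow_le_mul_exp {p η : ℝ} (hp : 0 < p) (hη : 0 < η) :
    ∃ P : ℝ, 0 < P ∧ ∀ s : ℝ, 0 ≤ s → s ^ p ≤ P * Real.exp (η * s) := by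
  refine ⟨(p / η) ^ p, by positivity, fun s hs => ?_⟩
  have h1 : s ≤ p / η * Real.exp (η * s / p) := by
    have := Real.add_one_le_exp (η * s / p)
    calc s = p / η * (η * s / p) := by field_simp
      _ ≤ _ := by gcongr; linarith
  calc s ^ p ≤ (p / η * Real.exp (η * s / p)) ^ p := by gcongr
    _ = _ := by
      rw [Real.mul_rpow (by positivity) (by positivity), ← Real.exp_mul]
      congr 2; field_simp

theorem gevrey_term_le {B δ u m : ℝ} {k : ℕ} (hB : 0 < B) (hδ : 0 ≤ δ) (hm : 0 < m)
    (h : 2 * B * (k : ℝ) ^ δ ≤ u * m) :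
    B ^ k * (k.factorial : ℝ) ^ δ * 2 ^ k / m ^ k ≤ u ^ k := by
  have h1 : (k.factorial : ℝ) ^ δ ≤ ((k : ℝ) ^ δ) ^ k := by
    rw [← Real.rpow_mul_natCast (by positivity), mul_comm, Real.rpow_natCast_mul (by positivity)]
    gcongr
    exact_mod_cast Nat.factorial_le_pow k
  rw [div_le_iff₀ (by positivity), ← mul_pow]
  calc B ^ k * (k.factorial : ℝ) ^ δ * 2 ^ k ≤ B ^ k * ((k : ℝ) ^ δ) ^ k * 2 ^ k := by gcongr
    _ = (2 * B * (k : ℝ) ^ δ) ^ k := by rw [← mul_pow, ← mul_pow]; ring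
    _ ≤ _ := by gcongr

theorem floor_mul_gevrey_le {B δ r s v m : ℝ} {k : ℕ} (hB : 0 < B) (hδ : 1 ≤ δ) (hs : 0 ≤ s)
    (hr : 1 ≤ r) (hsm : s ^ δ = m) (hk : (k : ℝ) ≤ s / r) (hv : 2 * B / r = v) :
    2 * B * (k : ℝ) ^ δ ≤ v * m := by
  have hm : 0 ≤ m := hsm ▸ by positivity
  have h1 : (k : ℝ) ^ δ ≤ m / r := by
    calc (k : ℝ) ^ δ ≤ (s / r) ^ δ := by gcongr
      _ = m / r ^ δ := by rw [Real.div_rpow hs (by linarith), hsm]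
      _ ≤ m / r := by
        gcongr
        exact Real.self_le_rpow_of_one_le hr hδ
  calc 2 * B * (k : ℝ) ^ δ ≤ 2 * B * (m / r) := by gcongr
    _ = v * m := by rw [← hv]; ring

set_option maxHeartbeats 1000000 in
theorem exists_gevrey_bound {δ : ℝ} (hδ : 1 ≤ δ) (β : ℝ) :
    ∃ M : ℝ, 0 < M ∧ ∀ B : ℝ, 0 < B → B ≤ β → ∀ m : ℕ, 1 ≤ m →
      B ≤ M * rho (1 / B) ^ (-(m : ℝ) ^ (1 / δ) / Real.exp 2) ∨
      ∃ k : ℕ, 2 ≤ k ∧ 2 * k ≤ m ∧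
        B ^ k * (k.factorial : ℝ) ^ δ * 2 ^ k / m ^ k * m ^ 2 ≤
          M * rho (1 / B) ^ (-(m : ℝ) ^ (1 / δ) / Real.exp 2) := by
  rcases le_or_gt β 0 with hβ | hβ
  · exact ⟨1, one_pos, fun B h1 h2 => absurd (h1.trans_le h2) (not_lt.2 hβ)⟩
  set e := Real.exp 1 with he
  have he1 : 2.7 < e := by linarith [Real.exp_one_gt_d9]
  have he2 : Real.exp 2 = e ^ 2 := by
    rw [he, ← Real.exp_nat_mul]; norm_num
  have hepos : 0 < e := Real.exp_pos 1
  have hε₁ : 0 < (1 / (2 * e) - 1 / e ^ 2) / β := by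
    apply div_pos _ hβ
    rw [sub_pos]
    apply one_div_lt_one_div_of_lt (by positivity)
    nlinarith
  have hε₂ : 0 < 1 / e - 2 / e ^ 2 := by
    rw [sub_pos, div_lt_div_iff₀ (by positivity) hepos]
    nlinarith
  obtain ⟨P₁, hP₁, hPs₁⟩ := exists_rpow_le_mul_exp (p := 2 * δ) (by linarith) hε₁
  obtain ⟨P₂, hP₂, hPs₂⟩ := exists_rpow_le_mul_exp (p := 2 * δ) (by linarith) hε₂
  refine ⟨β * Real.exp 2 + 5 / 2 + P₁ * e + P₂ * e, by positivity, fun B hB hBβ m hm => ?_⟩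
  set M := β * Real.exp 2 + 5 / 2 + P₁ * e + P₂ * e with hM
  have hM1 : β * Real.exp 2 ≤ M := by
    have : 0 < P₁ * e := by positivity
    have : 0 < P₂ * e := by positivity
    linarith
  have hM2 : 5 / 2 ≤ M := by
    have : 0 < P₁ * e := by positivity
    have : 0 < P₂ * e := by positivity
    have : 0 < β * Real.exp 2 := by positivity
    linarith
  have hM3 : P₁ * e ≤ M := by
    have : 0 < P₂ * e := by positivity
    have : 0 < β * Real.exp 2 := by positivity
    linarith
  have hM4 : P₂ * e ≤ M := by
    have : 0 < P₁ * e := by positivity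
    have : 0 < β * Real.exp 2 := by positivity
    linarith
  have hm1 : (1 : ℝ) ≤ m := by exact_mod_cast hm
  set s := (m : ℝ) ^ (1 / δ) with hs
  have hs0 : 0 < s := by positivity
  have hsδ : s ^ δ = m := by
    rw [hs, ← Real.rpow_mul (by positivity), one_div_mul_cancel (by linarith), Real.rpow_one]
  have hs2δ : (m : ℝ) ^ 2 = s ^ (2 * δ) := by
    rw [mul_comm, Real.rpow_mul hs0.le, hsδ]; norm_cast
  have hsm : s ≤ m := by
    calc s ≤ (m : ℝ) ^ (1 : ℝ) := by
          rw [hs]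
          apply Real.rpow_le_rpow_of_exponent_le hm1
          rw [div_le_one (by linarith)]; exact hδ
      _ = m := Real.rpow_one _
  set t := s / Real.exp 2 with ht
  have ht0 : 0 ≤ t := by positivity
  rw [neg_div, ← ht]
  set R := rho (1 / B) ^ (-t) with hR
  have hkm : ∀ k : ℕ, (k : ℝ) ≤ s / e → 2 * k ≤ m := by
    intro k hk
    rw [le_div_iff₀ hepos] at hk
    have : (2 : ℝ) * k ≤ m := by nlinarith [k.cast_nonneg (α := ℝ)]
    exact_mod_cast this
  rcases le_or_gt 1 (2 * B) with hB2 | hB2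
  · have hR1 : Real.exp (-t / B) ≤ R := exp_le_rho_rpow hB ht0
    rcases lt_or_ge s (4 * e * B) with hsB | hsB
    · left
      have htB : -2 ≤ -t / B := by
        rw [le_div_iff₀ hB, ht, he2]
        have : s / e ^ 2 ≤ 2 * B := by
          rw [div_le_iff₀ (by positivity)]
          nlinarith [mul_pos hB hepos]
        linarith
      calc B ≤ β * Real.exp 2 * Real.exp (-2) := by
            rw [mul_assoc, ← Real.exp_add]; simpa using hBβ
        _ ≤ M * R := by
            gcongr
            exact (Real.exp_le_exp.2 htB).trans hR1
    · right
      have hr : 1 ≤ 2 * e * B := by nlinarith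
      refine ⟨⌊s / (2 * e * B)⌋₊, ?_, ?_, ?_⟩
      · apply Nat.le_floor
        rw [le_div_iff₀ (by positivity)]
        push_cast; linarith
      · apply hkm
        refine (Nat.floor_le (by positivity)).trans ?_
        gcongr
        nlinarith
      · have h1 := gevrey_term_le (m := m) (k := ⌊s / (2 * e * B)⌋₊) hB (by linarith) (by linarith)
          (floor_mul_gevrey_le (v := 1 / e) hB hδ hs0.le hr hsδ (Nat.floor_le (by positivity))
            (by field_simp))
        have h2 : (1 / e) ^ ⌊s / (2 * e * B)⌋₊ ≤ e * Real.exp (-(s / (2 * e * B))) := by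
          rw [one_div, he, ← Real.exp_neg, ← Real.exp_nat_mul, ← Real.exp_add, ← he]
          apply Real.exp_le_exp.2
          have := Nat.lt_floor_add_one (s / (2 * e * B))
          linarith
        have h3 : (1 / (2 * e) - 1 / e ^ 2) / β * s ≤ (1 / (2 * e) - 1 / e ^ 2) / B * s := by
          gcongr
          have := mul_pos hε₁ hβ
          rw [div_mul_cancel₀ _ hβ.ne'] at this
          exact this.le
        calc _ ≤ (e * Real.exp (-(s / (2 * e * B)))) * (m : ℝ) ^ 2 := by
              gcongr; exact h1.trans h2
          _ ≤ (e * Real.exp (-(s / (2 * e * B)))) *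
              (P₁ * Real.exp ((1 / (2 * e) - 1 / e ^ 2) / B * s)) := by
              rw [hs2δ]
              gcongr
              exact (hPs₁ s hs0.le).trans (by gcongr)
          _ = P₁ * e * Real.exp (-t / B) := by
              rw [show ∀ a b c d : ℝ, a * b * (c * d) = c * a * (b * d) by intros; ring,
                ← Real.exp_add, ht, he2]
              congr 2
              field_simp
              ring
          _ ≤ M * R := by gcongr
  · have hR1 : (2 * B / 5) ^ t ≤ R := rpow_le_rho_rpow hB hB2.le ht0
    rcases lt_or_ge s (2 * e) with hse | hse
    · left
      have ht1 : t ≤ 1 := by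
        rw [ht, he2, div_le_one (by positivity)]
        nlinarith
      calc B = 5 / 2 * (2 * B / 5) ^ (1 : ℝ) := by rw [Real.rpow_one]; ring
        _ ≤ 5 / 2 * (2 * B / 5) ^ t := by
            gcongr 5 / 2 * ?_
            exact Real.rpow_le_rpow_of_exponent_ge (by positivity) (by linarith) ht1
        _ ≤ M * R := by gcongr
    · right
      have hfl := Nat.lt_floor_add_one (s / e)
      refine ⟨⌊s / e⌋₊, ?_, ?_, ?_⟩
      · apply Nat.le_floor
        rw [le_div_iff₀ (by positivity)]
        push_cast; linarith
      · exact hkm _ (Nat.floor_le (by positivity))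
      · have h1 := gevrey_term_le (m := m) (k := ⌊s / e⌋₊) hB (by linarith) (by linarith)
          (floor_mul_gevrey_le (v := 2 * B * (1 / e)) hB hδ hs0.le (by linarith) hsδ
            (Nat.floor_le (by positivity)) (by field_simp))
        have h2 : (1 / e) ^ ⌊s / e⌋₊ ≤ e * Real.exp (-(s / e)) := by
          rw [one_div, he, ← Real.exp_neg, ← Real.exp_nat_mul, ← Real.exp_add, ← he]
          apply Real.exp_le_exp.2
          linarith
        have h3 : (2 * B) ^ ⌊s / e⌋₊ ≤ (2 * B) ^ t := by
          rw [← Real.rpow_natCast]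
          apply Real.rpow_le_rpow_of_exponent_ge (by positivity) hB2.le
          have h4 : t + 1 ≤ s / e := by
            have h5 : 2 ≤ s / e := by rwa [le_div_iff₀ hepos]
            have h6 : t = s / e / e := by rw [ht, he2]; field_simp
            have h7 : t ≤ s / e / 2 := by
              rw [h6]; gcongr; linarith
            linarith
          linarith
        have h4 : Real.exp (-(2 * t)) ≤ (1 / 5) ^ t := by
          rw [show -(2 * t) = -2 * t by ring, Real.exp_mul]
          gcongr
          rw [Real.exp_neg, one_div, he2]
          gcongr
          nlinarith
        calc _ ≤ ((2 * B) ^ t * (e * Real.exp (-(s / e)))) * (m : ℝ) ^ 2 := by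
              gcongr
              refine h1.trans ?_
              rw [mul_pow]
              gcongr
          _ ≤ ((2 * B) ^ t * (e * Real.exp (-(s / e)))) *
              (P₂ * Real.exp ((1 / e - 2 / e ^ 2) * s)) := by
              rw [hs2δ]
              gcongr
              exact hPs₂ s hs0.le
          _ = P₂ * e * ((2 * B) ^ t * Real.exp (-(2 * t))) := by
              rw [show ∀ a b c d f : ℝ, a * (b * c) * (d * f) = d * b * (a * (c * f)) by
                intros; ring, ← Real.exp_add, ht, he2]
              congr 3
              field_simp
              ring
          _ ≤ P₂ * e * ((2 * B) ^ t * (1 / 5) ^ t) := by gcongr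
          _ = P₂ * e * (2 * B / 5) ^ t := by
              rw [← Real.mul_rpow (by positivity) (by positivity)]; ring_nf
          _ ≤ M * R := by gcongr

theorem exists_gevrey_approx {δ : ℝ} (hδ : 1 ≤ δ) (β : ℝ) :
    ∃ M : ℝ, 0 < M ∧ ∀ B : ℝ, 0 < B → B ≤ β → ∀ m : ℕ, 1 ≤ m → ∀ CG : ℝ, 0 < CG →
      ∀ G : ℕ → ℝ → ℝ,
        (∀ k, ∀ x ∈ Set.Icc (-1 : ℝ) 1, HasDerivAt (G k) (G (k + 1) x) x) →
        (∀ k, ∀ x ∈ Set.Icc (-1 : ℝ) 1, |G k x| ≤ CG * B ^ k * (k.factorial : ℝ) ^ δ) →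
        ∃ p : Polynomial ℝ, p.natDegree ≤ m ∧ ∀ x ∈ Set.Icc (-1 : ℝ) 1,
          |G 0 x - p.eval x| ≤
            M * CG * rho (1 / B) ^ (-(m : ℝ) ^ (1 / δ) / Real.exp 2) := by
  obtain ⟨M, hM0, hM⟩ := exists_gevrey_bound hδ β
  set S := ∑' n : ℕ, 1 / ((n : ℝ) + 1) ^ 2 with hS
  have hS0 : 0 ≤ S := tsum_nonneg fun n => by positivity
  refine ⟨M * (1 + 2 * S), by positivity, fun B hB hBβ m hm CG hCG G hd hG => ?_⟩
  have hR : 0 < rho (1 / B) ^ (-(m : ℝ) ^ (1 / δ) / Real.exp 2) :=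
    Real.rpow_pos_of_pos (rho_pos (by positivity)) _
  set R := rho (1 / B) ^ (-(m : ℝ) ^ (1 / δ) / Real.exp 2) with hRdef
  rcases hM B hB hBβ m hm with h | ⟨k, hk, hkm, h⟩
  · refine ⟨Polynomial.C (G 0 0), by simp, fun x hx => ?_⟩
    have h1 := (convex_Icc (-1 : ℝ) 1).norm_image_sub_le_of_norm_hasDerivWithin_le
      (fun y hy => (hd 0 y hy).hasDerivWithinAt) (hG 1) (by norm_num : (0 : ℝ) ∈ _) hx
    simp only [Real.norm_eq_abs, pow_one, Nat.factorial_one, Nat.cast_one, Real.one_rpow,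
      mul_one, sub_zero] at h1
    have hx1 : |x| ≤ 1 := abs_le.2 hx
    rw [Polynomial.eval_C]
    calc |G 0 x - G 0 0| ≤ CG * B * |x| := h1
      _ ≤ CG * B := mul_le_of_le_one_right (by positivity) hx1
      _ ≤ CG * (M * R) := by gcongr
      _ ≤ M * (1 + 2 * S) * CG * R := by
        have : 0 ≤ M * (2 * S) * CG * R := by positivity
        linarith
  · obtain ⟨p, hp, hpG⟩ := exists_polynomial_approx hd hG hk hkm
    refine ⟨p, hp, fun x hx => (hpG x hx).trans ?_⟩
    calc _ = 2 * CG * S * (B ^ k * (k.factorial : ℝ) ^ δ * 2 ^ k / m ^ k * m ^ 2) := by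
          rw [← hS]; ring
      _ ≤ 2 * CG * S * (M * R) := by gcongr
      _ ≤ M * (1 + 2 * S) * CG * R := by
        have : 0 ≤ M * CG * R := by positivity
        linarith

theorem hasDerivAt_deriv_iterate {φ : ℝ → ℝ} {V : Set ℝ} (hV : IsOpen V)
    (hφ : ContDiffOn ℝ (⊤ : ℕ∞) φ V) (k : ℕ) {t : ℝ} (ht : t ∈ V) :
    HasDerivAt (deriv^[k] φ) (deriv^[k + 1] φ t) t := by
  have key : ContDiffOn ℝ (⊤ : ℕ∞) (deriv^[k] φ) V := by
    induction k with
    | zero => exact hφ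
    | succ k ih =>
      rw [Function.iterate_succ_apply']
      exact ih.deriv_of_isOpen hV (by simp)
  rw [Function.iterate_succ_apply']
  exact ((key.differentiableOn (by simp)).differentiableAt (hV.mem_nhds ht)).hasDerivAt

theorem pderiv'_iterate_update {d : ℕ} (i : Fin d) (f : (Fin d → ℝ) → ℝ) (y : Fin d → ℝ) (k : ℕ)
    (t : ℝ) :
    (pderiv' i)^[k] f (Function.update y i t) =
      deriv^[k] (fun s => f (Function.update y i s)) t := by
  induction k generalizing t with
  | zero => rfl
  | succ k ih =>
    rw [Function.iterate_succ_apply', Function.iterate_succ_apply', pderiv']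
    simp only [Function.update_idem, Function.update_self, ih]

theorem foldr_comp_eq_of_forall_ne {ι α : Type*} {u : ι → α → α} {i : ι}
    (hu : ∀ j, j ≠ i → u j = id) (l : List ι) (hl : l.Nodup) :
    (i ∉ l → (l.map u).foldr (· ∘ ·) id = id) ∧ (i ∈ l → (l.map u).foldr (· ∘ ·) id = u i) := by
  induction l with
  | nil => simp
  | cons j l ih =>
    obtain ⟨hj, hl⟩ := List.nodup_cons.1 hl
    obtain ⟨ih1, ih2⟩ := ih hl
    rw [List.map_cons, List.foldr_cons]
    constructor
    · intro h
      rw [List.mem_cons, not_or] at h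
      rw [ih1 h.2, hu j (Ne.symm h.1), Function.comp_id]
    · intro h
      by_cases hji : j = i
      · subst hji
        rw [ih1 hj, Function.comp_id]
      · rw [ih2 ((List.mem_cons.1 h).resolve_left (Ne.symm hji)), hu j hji, Function.id_comp]

theorem mderiv_single {d : ℕ} (i : Fin d) (k : ℕ) (f : (Fin d → ℝ) → ℝ) :
    mderiv (Pi.single i k) f = (pderiv' i)^[k] f := by
  rw [mderiv, List.ofFn_eq_map]
  rw [(foldr_comp_eq_of_forall_ne (i := i) (fun j hj => ?_) _ (List.nodup_finRange d)).2
    (List.mem_finRange i), Pi.single_eq_same]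
  rw [Pi.single_eq_of_ne hj, Function.iterate_zero]

theorem update_mem_box {d : ℕ} {a b y : Fin d → ℝ} (hy : y ∈ box a b) {i : Fin d} {t : ℝ}
    (ht : t ∈ Set.Icc (a i) (b i)) : Function.update y i t ∈ box a b := by
  intro j
  by_cases h : j = i
  · subst h; simpa using ht
  · simpa [h] using hy j

theorem GevreyOnBox.exists_coord_approx {d : ℕ} {a b : Fin d → ℝ} {δ CG A : ℝ}
    {f : (Fin d → ℝ) → ℝ} (hf : GevreyOnBox a b δ CG A f) (hab : ∀ i, a i < b i) (hA : 0 < A)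
    (hCG : 0 < CG) {m : ℕ} {B E : ℝ} (hB : ∀ i, A * (b i - a i) / 2 ≤ B)
    (happ : ∀ G : ℕ → ℝ → ℝ,
        (∀ k, ∀ x ∈ Set.Icc (-1 : ℝ) 1, HasDerivAt (G k) (G (k + 1) x) x) →
        (∀ k, ∀ x ∈ Set.Icc (-1 : ℝ) 1, |G k x| ≤ CG * B ^ k * (k.factorial : ℝ) ^ δ) →
        ∃ p : Polynomial ℝ, p.natDegree ≤ m ∧ ∀ x ∈ Set.Icc (-1 : ℝ) 1,
          |G 0 x - p.eval x| ≤ E) (i : Fin d) {y : Fin d → ℝ} (hy : y ∈ box a b) :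
    ∃ p : Polynomial ℝ, p.natDegree ≤ m ∧ ∀ t ∈ Set.Icc (a i) (b i),
      |f (Function.update y i t) - p.eval t| ≤ E := by
  obtain ⟨⟨U, hU, hbU, hfU⟩, hbd⟩ := hf
  set φ : ℝ → ℝ := fun t => f (Function.update y i t) with hφ
  set V : Set ℝ := (Function.update y i) ⁻¹' U with hV
  have hupd : ContDiff ℝ (⊤ : ℕ∞) (Function.update y i) := contDiff_update _ y i
  have hVo : IsOpen V := hU.preimage hupd.continuous
  have hφV : ContDiffOn ℝ (⊤ : ℕ∞) φ V :=
    hfU.comp hupd.contDiffOn (Set.mapsTo_preimage _ _)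
  set h : ℝ := (b i - a i) / 2 with hh
  set c : ℝ := (a i + b i) / 2 with hc
  have hpos : 0 < h := by have := hab i; simp only [hh]; linarith
  have hmem : ∀ x ∈ Set.Icc (-1 : ℝ) 1, c + h * x ∈ Set.Icc (a i) (b i) := by
    intro x hx
    have ha : c + h * (-1) = a i := by simp only [hh, hc]; ring
    have hb : c + h * 1 = b i := by simp only [hh, hc]; ring
    rw [← ha, ← hb]
    constructor
    · gcongr; exact hx.1
    · gcongr; exact hx.2
  obtain ⟨p, hp, hpE⟩ := happ (fun k x => deriv^[k] φ (c + h * x) * h ^ k)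
    (by
      intro k x hx
      have h1 := hasDerivAt_deriv_iterate hVo hφV k (hbU (update_mem_box hy (hmem x hx)))
      have h2 : HasDerivAt (fun x => c + h * x) h x := by
        simpa using ((hasDerivAt_id x).const_mul h).const_add c
      have h3 := (h1.comp x h2).mul_const (h ^ k)
      exact h3.congr_deriv (by ring))
    (by
      intro k x hx
      have h1 := hbd (Pi.single i k) _ (update_mem_box hy (hmem x hx))
      rw [mderiv_single, pderiv'_iterate_update, Finset.sum_pi_single' i k Finset.univ,
        if_pos (Finset.mem_univ i)] at h1
      have h2 : ∏ j, (Pi.single (M := fun _ => ℕ) i k j).factorial = k.factorial := by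
        rw [Finset.prod_eq_single i]
        · simp
        · intro j _ hj; simp [hj]
        · simp
      rw [h2] at h1
      rw [abs_mul, abs_of_pos (pow_pos hpos k)]
      have h3 : A * h ≤ B := by simpa [hh, mul_div_assoc] using hB i
      calc _ ≤ CG * A ^ k * (k.factorial : ℝ) ^ δ * h ^ k := by gcongr
        _ = CG * (A * h) ^ k * (k.factorial : ℝ) ^ δ := by rw [mul_pow]; ring
        _ ≤ CG * B ^ k * (k.factorial : ℝ) ^ δ := by gcongr)
  refine ⟨p.comp (Polynomial.C h⁻¹ * (Polynomial.X - Polynomial.C c)), ?_, fun t ht => ?_⟩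
  · rw [Polynomial.natDegree_comp]
    refine le_trans (Nat.mul_le_mul_left _ ?_) ((mul_one _).le.trans hp)
    refine (Polynomial.natDegree_C_mul_le _ _).trans ?_
    rw [Polynomial.natDegree_X_sub_C]
  · have h1 := hpE (h⁻¹ * (t - c)) (by
      have e : h⁻¹ * (t - c) = (t - c) / h := by rw [div_eq_inv_mul]
      rw [e]
      constructor
      · rw [le_div_iff₀ hpos]; simp only [hh, hc]; linarith [ht.1]
      · rw [div_le_iff₀ hpos]; simp only [hh, hc]; linarith [ht.2])
    have h2 : c + h * (h⁻¹ * (t - c)) = t := by field_simp; ring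
    simpa [h2] using h1

theorem continuousOn_coordInterp {d m : ℕ} {a b : Fin d → ℝ} {nodes : Fin d → Fin (m + 1) → ℝ}
    (hn : ∀ i j, nodes i j ∈ Set.Icc (a i) (b i)) (i : Fin d) {f : (Fin d → ℝ) → ℝ}
    (hf : ContinuousOn f (box a b)) : ContinuousOn (coordInterp nodes i f) (box a b) := by
  unfold coordInterp
  simp only [Lagrange.interpolate_apply, Polynomial.eval_finsetSum, Polynomial.eval_mul,
    Polynomial.eval_C]
  refine continuousOn_finsetSum _ fun j _ => ?_
  refine ContinuousOn.mul ?_ ?_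
  · exact hf.comp (by fun_prop) fun y hy => update_mem_box hy (hn i j)
  · exact ((Polynomial.continuous _).comp (continuous_apply i)).continuousOn

theorem coordInterp_sub {d m : ℕ} (nodes : Fin d → Fin (m + 1) → ℝ) (i : Fin d)
    (f g : (Fin d → ℝ) → ℝ) (y : Fin d → ℝ) :
    coordInterp nodes i f y - coordInterp nodes i g y =
      coordInterp nodes i (fun z => f z - g z) y := by
  simp only [coordInterp, ← Polynomial.eval_sub, ← map_sub]
  rfl

/-- `Λ` is a sup-norm stability constant of Lagrange interpolation at the given nodes, in every
coordinate. -/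
def IsStableInterp {d m : ℕ} (a b : Fin d → ℝ) (nodes : Fin d → Fin (m + 1) → ℝ) (Λ : ℝ) : Prop :=
  ∀ i, ∀ g : ℝ → ℝ, ContinuousOn g (Set.Icc (a i) (b i)) →
    ∀ M : ℝ, (∀ x ∈ Set.Icc (a i) (b i), |g x| ≤ M) →
      ∀ y ∈ Set.Icc (a i) (b i),
        |(Lagrange.interpolate Finset.univ (nodes i) (fun j => g (nodes i j))).eval y| ≤ Λ * M

section

variable {d m : ℕ} {a b : Fin d → ℝ} {nodes : Fin d → Fin (m + 1) → ℝ} {Λ : ℝ}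
  {f : (Fin d → ℝ) → ℝ}

theorem continuousOn_slice (hf : ContinuousOn f (box a b)) (i : Fin d) {y : Fin d → ℝ}
    (hy : y ∈ box a b) :
    ContinuousOn (fun t => f (Function.update y i t)) (Set.Icc (a i) (b i)) :=
  hf.comp (by fun_prop) fun _ ht => update_mem_box hy ht

theorem IsStableInterp.abs_coordInterp_le (hst : IsStableInterp a b nodes Λ)
    (hf : ContinuousOn f (box a b)) {M : ℝ} (hM : ∀ y ∈ box a b, |f y| ≤ M) (i : Fin d)
    {y : Fin d → ℝ} (hy : y ∈ box a b) : |coordInterp nodes i f y| ≤ Λ * M :=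
  hst i (fun t => f (Function.update y i t)) (continuousOn_slice hf i hy) M
    (fun _ ht => hM _ (update_mem_box hy ht)) _ (hy i)

theorem IsStableInterp.abs_sub_coordInterp_le (hst : IsStableInterp a b nodes Λ)
    (hinj : ∀ i, Function.Injective (nodes i)) (hf : ContinuousOn f (box a b))
    {E : ℝ} {i : Fin d} {y : Fin d → ℝ} (hy : y ∈ box a b) {p : Polynomial ℝ} (hp : p.natDegree ≤ m)
    (hpE : ∀ t ∈ Set.Icc (a i) (b i), |f (Function.update y i t) - p.eval t| ≤ E) :
    |f y - coordInterp nodes i f y| ≤ (Λ + 1) * E := by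
  have h1 := hst i (fun t => f (Function.update y i t) - p.eval t)
    ((continuousOn_slice hf i hy).sub p.continuousOn) E hpE (y i) (hy i)
  have h2 := hpE (y i) (hy i)
  rw [Function.update_eq_self] at h2
  have h3 : p = Lagrange.interpolate Finset.univ (nodes i) (fun j => p.eval (nodes i j)) := by
    apply Lagrange.eq_interpolate (hinj i).injOn
    rw [Finset.card_univ, Fintype.card_fin]
    exact Polynomial.degree_le_natDegree.trans_lt (by exact_mod_cast Nat.lt_succ_of_le hp)
  have h4 : (Lagrange.interpolate Finset.univ (nodes i)
      (fun j => f (Function.update y i (nodes i j)) - p.eval (nodes i j))).eval (y i)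
      = coordInterp nodes i f y - p.eval (y i) := by
    conv_rhs => rw [h3]
    rw [coordInterp, ← Polynomial.eval_sub, ← map_sub]
    rfl
  rw [h4] at h1
  have h5 : f y - coordInterp nodes i f y
      = (f y - p.eval (y i)) - (coordInterp nodes i f y - p.eval (y i)) := by ring
  rw [h5]
  have := abs_sub (f y - p.eval (y i)) (coordInterp nodes i f y - p.eval (y i))
  linarith

theorem IsStableInterp.abs_sub_foldr_le (hst : IsStableInterp a b nodes Λ) (hΛ : 1 ≤ Λ)
    (hn : ∀ i j, nodes i j ∈ Set.Icc (a i) (b i)) (hf : ContinuousOn f (box a b)) {E : ℝ}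
    (hE0 : 0 ≤ E)
    (hE : ∀ i, ∀ y ∈ box a b, |f y - coordInterp nodes i f y| ≤ (Λ + 1) * E) (l : List (Fin d)) :
    ContinuousOn ((l.map (coordInterp nodes)).foldr (· ∘ ·) id f) (box a b) ∧
      ∀ y ∈ box a b, |f y - (l.map (coordInterp nodes)).foldr (· ∘ ·) id f y| ≤
        l.length * (Λ + 1) ^ l.length * E := by
  induction l with
  | nil => exact ⟨hf, fun y _ => by simp⟩
  | cons i l ih =>
    obtain ⟨ihc, ihE⟩ := ih
    rw [List.map_cons, List.foldr_cons]
    refine ⟨continuousOn_coordInterp hn i ihc, fun y hy => ?_⟩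
    set g := (l.map (coordInterp nodes)).foldr (· ∘ ·) id f with hg
    have h1 := hst.abs_coordInterp_le (hf.sub ihc) ihE i hy
    have h2 := coordInterp_sub nodes i f g y
    change |f y - coordInterp nodes i g y| ≤ _
    have h3 : f y - coordInterp nodes i g y = (f y - coordInterp nodes i f y)
        + coordInterp nodes i (fun z => f z - g z) y := by rw [← h2]; ring
    rw [h3, List.length_cons]
    refine (abs_add_le _ _).trans ((add_le_add (hE i y hy) h1).trans ?_)
    have h4 : (Λ + 1) ≤ (Λ + 1) ^ (l.length + 1) := le_self_pow₀ (by linarith) (by omega)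
    have h5 : Λ * (l.length * (Λ + 1) ^ l.length * E) ≤
        (Λ + 1) * (l.length * (Λ + 1) ^ l.length * E) := by
      gcongr; linarith
    calc _ ≤ (Λ + 1) ^ (l.length + 1) * E + (Λ + 1) * (l.length * (Λ + 1) ^ l.length * E) := by
          gcongr
      _ = _ := by push_cast; ring

end

/-- There is `C : (0,∞)×[1,∞) → (0,∞)`, monotonically increasing in its first
argument, such that for every `d ≥ 1`, every box `Q = ∏_i [a_i,b_i]`, every
`m ≥ 3`, every choice of `m+1` distinct nodes in each `[a_i,b_i]` whose
univariate Lagrange interpolation satisfies the sup-norm stability bound with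
constant `Λ_m ≥ 1`, every `δ ≥ 1`, `C_G, A > 0` and every
`f ∈ G^δ(Q, C_G, A)`, the tensor-product interpolant satisfies
`‖f - 𝓘_m^Q f‖_{C(Q)} ≤ C(A·diam_∞(Q)/2, δ) · C_G · d · (Λ_m+1)^d ·
ρ(2/(A·diam_∞(Q)))^{-m^{1/δ}/e²}`. -/
theorem stmt2 :
    ∃ C : ℝ → ℝ → ℝ,
      (∀ B δ : ℝ, 0 < B → 1 ≤ δ → 0 < C B δ) ∧
      (∀ B₁ B₂ δ : ℝ, 0 < B₁ → B₁ ≤ B₂ → 1 ≤ δ → C B₁ δ ≤ C B₂ δ) ∧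
      ∀ d : ℕ, 1 ≤ d →
        ∀ a b : Fin d → ℝ, (∀ i, a i < b i) →
          ∀ m : ℕ, 3 ≤ m →
            ∀ nodes : Fin d → Fin (m + 1) → ℝ,
              (∀ i, Function.Injective (nodes i)) →
              (∀ i j, nodes i j ∈ Set.Icc (a i) (b i)) →
              ∀ Λ : ℝ, 1 ≤ Λ →
                (∀ i, ∀ g : ℝ → ℝ, ContinuousOn g (Set.Icc (a i) (b i)) →
                  ∀ M : ℝ, (∀ x ∈ Set.Icc (a i) (b i), |g x| ≤ M) →
                    ∀ y ∈ Set.Icc (a i) (b i),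
                      |(Lagrange.interpolate Finset.univ (nodes i)
                        (fun j => g (nodes i j))).eval y| ≤ Λ * M) →
                ∀ δ CG A : ℝ, 1 ≤ δ → 0 < CG → 0 < A →
                  ∀ f : (Fin d → ℝ) → ℝ, GevreyOnBox a b δ CG A f →
                    ∀ y ∈ box a b,
                      |f y - tensorInterp nodes f y| ≤
                        C (A * diamInf a b / 2) δ * CG * d * (Λ + 1) ^ d *
                          rho (2 / (A * diamInf a b)) ^
                            (-(m : ℝ) ^ (1 / δ) / Real.exp 2) := by
  have hex : ∀ (δ : ℝ) (n : ℕ), ∃ M : ℝ, 0 < M ∧ (1 ≤ δ → ∀ B : ℝ, 0 < B → B ≤ n →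
      ∀ m : ℕ, 1 ≤ m → ∀ CG : ℝ, 0 < CG → ∀ G : ℕ → ℝ → ℝ,
        (∀ k, ∀ x ∈ Set.Icc (-1 : ℝ) 1, HasDerivAt (G k) (G (k + 1) x) x) →
        (∀ k, ∀ x ∈ Set.Icc (-1 : ℝ) 1, |G k x| ≤ CG * B ^ k * (k.factorial : ℝ) ^ δ) →
        ∃ p : Polynomial ℝ, p.natDegree ≤ m ∧ ∀ x ∈ Set.Icc (-1 : ℝ) 1,
          |G 0 x - p.eval x| ≤
            M * CG * rho (1 / B) ^ (-(m : ℝ) ^ (1 / δ) / Real.exp 2)) := by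
    intro δ n
    by_cases hδ : 1 ≤ δ
    · obtain ⟨M, hM0, hM⟩ := exists_gevrey_approx hδ n
      exact ⟨M, hM0, fun _ => hM⟩
    · exact ⟨1, one_pos, fun h => absurd h hδ⟩
  choose M hM0 hM using hex
  refine ⟨fun B δ => ∑ n ∈ Finset.range (⌈B⌉₊ + 1), M δ n, fun B δ _ _ => ?_,
    fun B₁ B₂ δ _ h12 _ => ?_, ?_⟩
  · exact Finset.sum_pos (fun n _ => hM0 δ n) ⟨0, by simp⟩
  · refine Finset.sum_le_sum_of_subset_of_nonneg ?_ fun n _ _ => (hM0 δ n).le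
    exact Finset.range_subset_range.2 (by gcongr)
  intro d hd a b hab m hm nodes hinj hn Λ hΛ hst δ CG A hδ hCG hA f hf y hy
  have hdiam : ∀ i, b i - a i ≤ diamInf a b := fun i =>
    le_ciSup (f := fun i => b i - a i) (Set.finite_range _).bddAbove i
  have hdpos : 0 < diamInf a b :=
    (sub_pos.2 (hab ⟨0, hd⟩)).trans_le (hdiam ⟨0, hd⟩)
  set B := A * diamInf a b / 2 with hB
  have hBpos : 0 < B := by positivity
  have hrho : 2 / (A * diamInf a b) = 1 / B := by rw [hB, one_div_div]
  rw [hrho]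
  set R := rho (1 / B) ^ (-(m : ℝ) ^ (1 / δ) / Real.exp 2) with hR
  have hRpos : 0 < R := Real.rpow_pos_of_pos (rho_pos (by positivity)) _
  set K := M δ ⌈B⌉₊ with hK
  have hKpos : 0 < K := hM0 _ _
  have hcont : ContinuousOn f (box a b) := by
    obtain ⟨⟨U, _, hbU, hfU⟩, _⟩ := hf
    exact hfU.continuousOn.mono hbU
  have hst' : IsStableInterp a b nodes Λ := hst
  have hcoord : ∀ i, ∀ z ∈ box a b, |f z - coordInterp nodes i f z| ≤ (Λ + 1) * (K * CG * R) := by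
    intro i z hz
    obtain ⟨p, hp, hpE⟩ := hf.exists_coord_approx hab hA hCG
      (fun i => by rw [hB]; gcongr; exact hdiam i)
      (hM δ ⌈B⌉₊ hδ B hBpos (Nat.le_ceil B) m (by omega) CG hCG) i hz
    exact hst'.abs_sub_coordInterp_le hinj hcont hz hp hpE
  have key := (hst'.abs_sub_foldr_le hΛ hn hcont (by positivity) hcoord (List.finRange d)).2 y hy
  rw [List.length_finRange, ← List.ofFn_eq_map] at key
  have hKle : K ≤ ∑ n ∈ Finset.range (⌈B⌉₊ + 1), M δ n :=
    Finset.single_le_sum (fun n _ => (hM0 δ n).le) (by simp)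
  calc |f y - tensorInterp nodes f y| ≤ d * (Λ + 1) ^ d * (K * CG * R) := key
    _ = K * CG * d * (Λ + 1) ^ d * R := by ring
    _ ≤ _ := by
      gcongr
end
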